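/- Let n ≥ 1 and j ∈ [n−1]. (1) Let λ ∈ ℤⁿ be dominant with λ₁ ≥ … ≥ λₙ ≥ 0, let ℓ ≥ ℓ(λ), and let E ∈ B(ϖ_ℓ) be a column such that E ⊗ T⁰_λ is semistandard. If j ∉ E and j+1 ∈ E, then Ψ_{E⊗T⁰_λ} = tT_j⁻¹ Ψ_{s_jE⊗T⁰_λ}. (2) For any column E ∈ B(ϖ_ℓ) with s_jE ≤ E (i.e. not (j ∈ E and j+1 ∉ E)), one has Ψ_E = tT_j⁻¹ Ψ_{s_jE}. -/

import Mathlib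

set_option maxHeartbeats 1000000

attribute [local instance] Classical.propDecidable

noncomputable section

namespace HLHecke

/-- The base ring `ℤ[t^{±1}]` of Laurent polynomials. -/
abbrev HR : Type := LaurentPolynomial ℤ

/-- The parameter `t`. -/
def tt : HR := LaurentPolynomial.T 1

/-! ### The symmetric group on `Fin n` -/

/-- The simple transposition `s_j = (j, j+1)` (junk value `1` if out of range). -/
def sgen (n : ℕ) (j : ℕ) : Equiv.Perm (Fin n) :=
  if h : j + 1 < n then Equiv.swap ⟨j, Nat.lt_of_succ_lt h⟩ ⟨j + 1, h⟩ else 1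

/-- The product `s_{i₁} ⋯ s_{i_ℓ}` of a word `l = [i₁, …, i_ℓ]`. -/
def wordProd (n : ℕ) (l : List ℕ) : Equiv.Perm (Fin n) := (l.map (sgen n)).prod

/-- The action of `S_n` on `ℤⁿ` by permutation of coordinates. -/
def wAct (n : ℕ) (w : Equiv.Perm (Fin n)) (μ : Fin n → ℤ) : Fin n → ℤ := fun i => μ (w⁻¹ i)

/-- The standard inner product on `ℤⁿ`. -/
def ip (n : ℕ) (μ ν : Fin n → ℤ) : ℤ := ∑ i, μ i * ν i

/-- The standard basis vector `ε_i`. -/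
def eps (n : ℕ) (i : Fin n) : Fin n → ℤ := fun k => if k = i then 1 else 0

/-- The simple root `α_j = ε_j − ε_{j+1}` (0-indexed: entries `j` and `j+1` of `Fin n`). -/
def alpha (n : ℕ) (j : ℕ) : Fin n → ℤ :=
  fun i => if (i : ℕ) = j then 1 else if (i : ℕ) = j + 1 then -1 else 0

/-- The fundamental weight `ϖ_k = ε₁ + … + ε_k`. -/
def varpi (n : ℕ) (k : ℕ) : Fin n → ℤ := fun i => if (i : ℕ) < k then 1 else 0

/-- The set of positive roots `R₊`. -/
def Rpos (n : ℕ) (β : Fin n → ℤ) : Prop := ∃ i j : Fin n, i < j ∧ β = eps n i - eps n j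

/-- The Coxeter length: minimal length of a word in the simple transpositions. -/
def len (n : ℕ) (w : Equiv.Perm (Fin n)) : ℕ :=
  sInf {k | ∃ l : List ℕ, (∀ j ∈ l, j + 1 < n) ∧ l.length = k ∧ wordProd n l = w}

/-- A choice of reduced word for `w`. -/
def redWord (n : ℕ) (w : Equiv.Perm (Fin n)) : List ℕ :=
  if h : ∃ l : List ℕ, (∀ j ∈ l, j + 1 < n) ∧ l.length = len n w ∧ wordProd n l = w
  then h.choose else []

/-! ### Columns -/

lemma col_card_le (n : ℕ) (C : Finset (Fin n)) : C.card ≤ n := by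
  simpa using Finset.card_le_univ C

/-- The minimal length coset representative `u_C` attached to a column `C`:
it sends `1, …, ℓ` to the entries of `C` in increasing order and `ℓ+1, …, n` to the
entries of the complement of `C` in increasing order. -/
def colPerm (n : ℕ) (C : Finset (Fin n)) : Equiv.Perm (Fin n) :=
  ((finCongr ((Nat.add_sub_cancel' (col_card_le n C)).symm)).trans
    finSumFinEquiv.symm).trans <|
  ((Equiv.sumCongr (C.orderIsoOfFin rfl).toEquiv
      ((Cᶜ.orderIsoOfFin (by simp [Finset.card_compl])).toEquiv)).trans <|
    (Equiv.sumCongr (Equiv.refl _) (Equiv.subtypeEquivRight (fun x => Finset.mem_compl))).trans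
      (Equiv.sumCompl (fun x => x ∈ C)))

/-- The `k`-th smallest entry of a column (0-indexed, as a natural number; junk `0` if
out of range). -/
def nth (n : ℕ) (C : Finset (Fin n)) (k : ℕ) : ℕ := ((C.sort (· ≤ ·)).map Fin.val).getD k 0

/-- The action of the simple transposition `s_j` on columns. -/
def sCol (n : ℕ) (j : ℕ) (C : Finset (Fin n)) : Finset (Fin n) := C.image (sgen n j)

/-- Semistandardness of the two-column filling `F ⊗ E` (`F` the left column):
entrywise `f_i ≤ e_i`. -/
def pairSS (n : ℕ) (F E : Finset (Fin n)) : Prop := ∀ k < E.card, nth n F k ≤ nth n E k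

/-- A filling by columns (leftmost column first) is semistandard iff all adjacent pairs are. -/
def isSSYT (n : ℕ) (L : List (Finset (Fin n))) : Prop := L.Chain' (pairSS n)

/-- The set `B(ϖ_ℓ)` of columns of length `ℓ`. -/
def colFinset (n : ℕ) (ℓ : ℕ) : Finset (Finset (Fin n)) := Finset.univ.filter fun C => C.card = ℓ

/-- The highest weight column `(1, …, k)`. -/
def hwCol (n : ℕ) (k : ℕ) : Finset (Fin n) := Finset.univ.filter fun x => (x : ℕ) < k

/-- The vector `⃗C ∈ ℤⁿ` attached to a column `C`. -/
def vecOf (n : ℕ) (C : Finset (Fin n)) : Fin n → ℤ := fun i => if i ∈ C then 1 else 0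

/-- The sign `σ^j_C`: `-1` if `j ∈ C` and `j+1 ∉ C`, and `+1` otherwise. -/
def sigmaSign (n : ℕ) (j : ℕ) (C : Finset (Fin n)) : ℤ :=
  if h : j + 1 < n then
    (if (⟨j, Nat.lt_of_succ_lt h⟩ : Fin n) ∈ C ∧ (⟨j + 1, h⟩ : Fin n) ∉ C then -1 else 1)
  else 1

/-! ### Shapes and tableaux -/

/-- The length `λ'_{j+1}` of the `(j+1)`-st column (0-indexed `j`) of the Young diagram
of a partition `λ`. -/
def shapeColLen (n : ℕ) (μ : Fin n → ℤ) (j : ℕ) : ℕ :=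
  (Finset.univ.filter fun i : Fin n => (j : ℤ) < μ i).card

/-- The number of columns of the Young diagram of a dominant weight. -/
def numCols (n : ℕ) (μ : Fin n → ℤ) : ℕ := Finset.univ.sup fun i : Fin n => (μ i).toNat

/-- The highest weight tableau `T⁰_μ`: row `i` is filled with `i`, i.e. its columns are the
highest weight columns. -/
def hwTableau (n : ℕ) (μ : Fin n → ℤ) : List (Finset (Fin n)) :=
  List.ofFn fun j : Fin (numCols n μ) => hwCol n (shapeColLen n μ (j : ℕ))

/-- The content vector of a tableau: `(wtVec T) i` is the number of entries equal to `i`. -/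
def wtVec (n : ℕ) (L : List (Finset (Fin n))) : Fin n → ℤ :=
  fun i => ((L.filter fun C => i ∈ C).length : ℤ)

/-! ### Macdonald's ψ statistic -/

/-- Number of entries `≤ i` in the column at position `p` (0-indexed from the left). -/
def colCount (n : ℕ) (L : List (Finset (Fin n))) (i p : ℕ) : ℕ :=
  ((L.getD p ∅).filter fun x => (x : ℕ) < i).card

/-- The factor `ψ_{T_{≤ i+1}/T_{≤ i}}` of Macdonald's ψ. -/
def stripFactor (n : ℕ) (L : List (Finset (Fin n))) (i : ℕ) : HR :=
  ∏ p ∈ Finset.range L.length,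
    if colCount n L (i + 1) p = colCount n L i p ∧
        colCount n L (i + 1) (p + 1) = colCount n L i (p + 1) + 1 then
      1 - tt ^ (colCount n L i p - colCount n L i (p + 1))
    else 1

/-- Macdonald's `ψ_T = ∏_{i=1}^{n-1} ψ_{T_{≤ i+1}/T_{≤ i}}` for a semistandard tableau. -/
def macPsi (n : ℕ) (L : List (Finset (Fin n))) : HR := ∏ i ∈ Finset.Ico 1 n, stripFactor n L i

/-- Macdonald's tableau statistic, extended by `0` to non-semistandard fillings. -/
def psiT (n : ℕ) (L : List (Finset (Fin n))) : HR := if isSSYT n L then macPsi n L else 0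

/-! ### The affine Hecke algebra -/

/-- Generators of the affine Hecke algebra. -/
inductive AGen (n : ℕ) : Type
  | T : ℕ → AGen n
  | X : Fin n → AGen n
  | Xinv : Fin n → AGen n

/-- The free algebra on the generators. -/
abbrev FA (n : ℕ) := FreeAlgebra HR (AGen n)

def fT (n : ℕ) (j : ℕ) : FA n := FreeAlgebra.ι HR (AGen.T j)
def fX (n : ℕ) (i : Fin n) : FA n := FreeAlgebra.ι HR (AGen.X i)
def fXi (n : ℕ) (i : Fin n) : FA n := FreeAlgebra.ι HR (AGen.Xinv i)

/-- The defining relations of the type `GL_n` affine Hecke algebra. -/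
inductive ARel (n : ℕ) : FA n → FA n → Prop
  | junk (j : ℕ) (h : ¬ j + 1 < n) : ARel n (fT n j) 1
  | quad (j : ℕ) (h : j + 1 < n) :
      ARel n (fT n j * fT n j) ((tt - 1) • fT n j + algebraMap HR (FA n) tt)
  | braid (j : ℕ) (h : j + 2 < n) :
      ARel n (fT n j * fT n (j + 1) * fT n j) (fT n (j + 1) * fT n j * fT n (j + 1))
  | commT (j k : ℕ) (hjk : j + 1 < k) (hk : k + 1 < n) :
      ARel n (fT n j * fT n k) (fT n k * fT n j)
  | commX (i i' : Fin n) : ARel n (fX n i * fX n i') (fX n i' * fX n i)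
  | XinvL (i : Fin n) : ARel n (fX n i * fXi n i) 1
  | XinvR (i : Fin n) : ARel n (fXi n i * fX n i) 1
  | TXT (j : ℕ) (h : j + 1 < n) :
      ARel n (fT n j * fX n ⟨j, Nat.lt_of_succ_lt h⟩ * fT n j) (tt • fX n ⟨j + 1, h⟩)
  | TXcomm (j : ℕ) (h : j + 1 < n) (i : Fin n) (hi1 : (i : ℕ) ≠ j) (hi2 : (i : ℕ) ≠ j + 1) :
      ARel n (fT n j * fX n i) (fX n i * fT n j)

/-- The type `GL_n` affine Hecke algebra. -/
abbrev H (n : ℕ) := RingQuot (ARel n)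

/-- The generator `T_j` of the (affine) Hecke algebra. -/
def Tg (n : ℕ) (j : ℕ) : H n := RingQuot.mkAlgHom HR (ARel n) (fT n j)

/-- The generator `X_i`. -/
def Xg (n : ℕ) (i : Fin n) : H n := RingQuot.mkAlgHom HR (ARel n) (fX n i)

/-- The generator `X_i⁻¹`. -/
def Xig (n : ℕ) (i : Fin n) : H n := RingQuot.mkAlgHom HR (ARel n) (fXi n i)

/-- The scalar `t` inside `H`. -/
def tH (n : ℕ) : H n := algebraMap HR (H n) tt

/-- The scalar `t^k` inside `H`. -/
def tpow (n : ℕ) (k : ℕ) : H n := algebraMap HR (H n) (tt ^ k)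

/-- The monomial `X^μ` for `μ ∈ ℤⁿ`. -/
def Xmon (n : ℕ) (μ : Fin n → ℤ) : H n :=
  (List.ofFn fun i : Fin n =>
    if 0 ≤ μ i then Xg n i ^ (μ i).toNat else Xig n i ^ (-μ i).toNat).prod

/-- The product `T_{i₁} ⋯ T_{i_ℓ}` of a word. -/
def TofWord (n : ℕ) (l : List ℕ) : H n := (l.map (Tg n)).prod

/-- The element `T_w`, defined via a choice of reduced word for `w`. -/
def Tw (n : ℕ) (w : Equiv.Perm (Fin n)) : H n := TofWord n (redWord n w)

/-- The finite Hecke symmetrizer `1₀ = Σ_{w ∈ S_n} T_w`. -/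
def one0 (n : ℕ) : H n := ∑ w : Equiv.Perm (Fin n), Tw n w

/-- The stabilizer `S_{n,λ}` as a finset. -/
def stabFinset (n : ℕ) (lam : Fin n → ℤ) : Finset (Equiv.Perm (Fin n)) :=
  Finset.univ.filter fun w => wAct n w lam = lam

/-- The parabolic symmetrizer `1_λ = Σ_{w ∈ S_{n,λ}} T_w`. -/
def onePara (n : ℕ) (lam : Fin n → ℤ) : H n := ∑ w ∈ stabFinset n lam, Tw n w

/-- The Poincaré polynomial `W_λ(t) = Σ_{w ∈ S_{n,λ}} t^{ℓ(w)}`. -/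
def Wlam (n : ℕ) (lam : Fin n → ℤ) : HR := ∑ w ∈ stabFinset n lam, tt ^ len n w

/-- The parabolic subalgebra `H_{n,λ}`, as the span of `{T_w : w ∈ S_{n,λ}}`. -/
def HparaM (n : ℕ) (lam : Fin n → ℤ) : Submodule HR (H n) :=
  Submodule.span HR (Tw n '' {w | wAct n w lam = lam})

/-- The finite Hecke algebra `H_n`, the subalgebra generated by the `T_j`. -/
def Hfin (n : ℕ) : Subalgebra HR (H n) := Algebra.adjoin HR (Set.range (Tg n))

/-- The coefficient `h_{C, S}` of the parabolic decomposition
`h = Σ_{F ∈ B(ϖ_ℓ)} T_{u_F} h_F` (defined via choice; it is unique). -/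
def paraCoeff (n : ℕ) (ℓ : ℕ) (h : H n) (C : Finset (Fin n)) : H n :=
  if hex : ∃ g : Finset (Fin n) → H n,
      (∀ F : Finset (Fin n), F.card = ℓ → g F ∈ HparaM n (varpi n ℓ)) ∧
      h = ∑ F ∈ colFinset n ℓ, Tw n (colPerm n F) * g F
  then hex.choose C else 0

/-- The elements `Ψ_T` of the finite Hecke algebra, defined by recursion on the columns of `T`
(leftmost column first).  By convention `Ψ` of the empty tableau is `1₀`. -/
def Psi (n : ℕ) : List (Finset (Fin n)) → H n
  | [] => one0 n
  | [C] => tpow n (len n (colPerm n C)) * Ring.inverse (Tw n (colPerm n C)⁻¹) *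
      onePara n (varpi n C.card)
  | C :: S => tpow n (len n (colPerm n C)) * Ring.inverse (Tw n (colPerm n C)⁻¹) *
      paraCoeff n C.card (Psi n S) C

end HLHecke
namespace HLHecke

/-! ### Inversions and length -/

lemma sgen_eq (n j : ℕ) (h : j + 1 < n) :
    sgen n j = Equiv.swap ⟨j, Nat.lt_of_succ_lt h⟩ ⟨j + 1, h⟩ := by
  simp [sgen, h]

lemma sgen_mul_self (n j : ℕ) : sgen n j * sgen n j = 1 := by
  unfold sgen; split_ifs <;> simp

lemma sgen_inv (n j : ℕ) : (sgen n j)⁻¹ = sgen n j := by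
  unfold sgen; split_ifs <;> simp

lemma sgen_sgen (n j : ℕ) (x : Fin n) : sgen n j (sgen n j x) = x := by
  rw [← Equiv.Perm.mul_apply, sgen_mul_self]; rfl

lemma sgen_cancel (n j : ℕ) (w : Equiv.Perm (Fin n)) : sgen n j * (sgen n j * w) = w := by
  rw [← mul_assoc, sgen_mul_self, one_mul]

lemma sgen_cancel_right (n j : ℕ) (w : Equiv.Perm (Fin n)) : w * sgen n j * sgen n j = w := by
  rw [mul_assoc, sgen_mul_self, mul_one]

lemma sgen_val (n j : ℕ) (h : j + 1 < n) (x : Fin n) :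
    ((sgen n j x : Fin n) : ℕ) = if (x : ℕ) = j then j + 1 else if (x : ℕ) = j + 1 then j else x := by
  rw [sgen_eq n j h, Equiv.swap_apply_def]
  by_cases h1 : (x : ℕ) = j
  · rw [if_pos (Fin.ext h1), if_pos h1]
  · rw [if_neg (fun e => h1 (congrArg Fin.val e)), if_neg h1]
    by_cases h2 : (x : ℕ) = j + 1
    · rw [if_pos (Fin.ext h2), if_pos h2]
    · rw [if_neg (fun e => h2 (congrArg Fin.val e)), if_neg h2]

lemma sgen_lt (n j : ℕ) (h : j + 1 < n) (a b : Fin n) (hab : a < b)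
    (hne : ¬ ((a : ℕ) = j ∧ (b : ℕ) = j + 1)) : sgen n j a < sgen n j b := by
  rw [Fin.lt_def] at hab ⊢
  rw [sgen_val n j h, sgen_val n j h]
  split_ifs <;> omega

/-- inversion set -/
def invSet (n : ℕ) (w : Equiv.Perm (Fin n)) : Finset (Fin n × Fin n) :=
  Finset.univ.filter fun p => p.1 < p.2 ∧ w p.2 < w p.1

lemma mem_invSet (n : ℕ) (w : Equiv.Perm (Fin n)) (a b : Fin n) :
    (a, b) ∈ invSet n w ↔ a < b ∧ w b < w a := by
  simp [invSet]

def inv (n : ℕ) (w : Equiv.Perm (Fin n)) : ℕ := (invSet n w).card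

/-- right ascent -/
def rasc (n j : ℕ) (h : j + 1 < n) (w : Equiv.Perm (Fin n)) : Prop :=
  w ⟨j, Nat.lt_of_succ_lt h⟩ < w ⟨j + 1, h⟩

lemma sgen_j (n j : ℕ) (h : j + 1 < n) :
    sgen n j ⟨j, Nat.lt_of_succ_lt h⟩ = ⟨j + 1, h⟩ := by
  rw [sgen_eq n j h]; simp

lemma sgen_j1 (n j : ℕ) (h : j + 1 < n) :
    sgen n j ⟨j + 1, h⟩ = ⟨j, Nat.lt_of_succ_lt h⟩ := by
  rw [sgen_eq n j h]; simp

lemma rasc_mul (n j : ℕ) (h : j + 1 < n) (w : Equiv.Perm (Fin n)) :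
    rasc n j h (w * sgen n j) ↔ ¬ rasc n j h w := by
  unfold rasc
  rw [Equiv.Perm.mul_apply, Equiv.Perm.mul_apply, sgen_j n j h, sgen_j1 n j h, not_lt]
  refine ⟨le_of_lt, fun h1 => lt_of_le_of_ne h1 ?_⟩
  intro h2
  have h3 := congrArg Fin.val (w.injective h2)
  change j + 1 = j at h3
  omega

lemma inv_mul (n j : ℕ) (h : j + 1 < n) (w : Equiv.Perm (Fin n)) (ha : rasc n j h w) :
    inv n (w * sgen n j) = inv n w + 1 := by
  unfold inv
  have e : invSet n (w * sgen n j) = insert (⟨j, Nat.lt_of_succ_lt h⟩, ⟨j + 1, h⟩)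
      ((invSet n w).image fun p => (sgen n j p.1, sgen n j p.2)) := by
    ext ⟨a, b⟩
    simp only [mem_invSet, Finset.mem_insert,
      Finset.mem_image, Prod.mk.injEq, Prod.exists, Equiv.Perm.mul_apply]
    constructor
    · rintro ⟨h1, h2⟩
      by_cases hh : (a : ℕ) = j ∧ (b : ℕ) = j + 1
      · left; exact ⟨Fin.ext hh.1, Fin.ext hh.2⟩
      · right
        exact ⟨sgen n j a, sgen n j b, ⟨sgen_lt n j h a b h1 hh, h2⟩, sgen_sgen _ _ _, sgen_sgen _ _ _⟩
    · rintro (⟨rfl, rfl⟩ | ⟨c, d, ⟨h1, h2⟩, rfl, rfl⟩)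
      · rw [sgen_j n j h, sgen_j1 n j h]
        refine ⟨?_, ha⟩
        exact Nat.lt_succ_self j
      · rw [sgen_sgen, sgen_sgen]
        refine ⟨sgen_lt n j h c d h1 ?_, h2⟩
        rintro ⟨h3, h4⟩
        have h3 : c = ⟨j, Nat.lt_of_succ_lt h⟩ := Fin.ext h3
        have h4 : d = ⟨j + 1, h⟩ := Fin.ext h4
        subst h3 h4
        exact absurd ha (not_lt.2 h2.le)
  rw [e, Finset.card_insert_of_notMem, Finset.card_image_of_injective]
  · rintro ⟨a, b⟩ ⟨c, d⟩ hh
    simpa using hh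
  · simp only [Finset.mem_image, Prod.mk.injEq, Prod.exists, not_exists, not_and, mem_invSet]
    rintro a b ⟨h1, h2⟩ h3 h4
    have h3 : a = ⟨j + 1, h⟩ := by rw [← sgen_j n j h, ← h3, sgen_sgen]
    have h4 : b = ⟨j, Nat.lt_of_succ_lt h⟩ := by rw [← sgen_j1 n j h, ← h4, sgen_sgen]
    subst h3 h4
    simp [Fin.lt_def] at h1

lemma inv_mul_desc (n j : ℕ) (h : j + 1 < n) (w : Equiv.Perm (Fin n)) (ha : ¬ rasc n j h w) :
    inv n (w * sgen n j) + 1 = inv n w := by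
  have := inv_mul n j h (w * sgen n j) ((rasc_mul n j h w).2 ha)
  rw [sgen_cancel_right] at this
  exact this.symm

lemma inv_one (n : ℕ) : inv n 1 = 0 := by
  simp only [inv, invSet, Finset.card_eq_zero, Finset.filter_eq_empty_iff]
  rintro ⟨a, b⟩ -
  simp only [Equiv.Perm.one_apply, not_and, not_lt]
  exact le_of_lt

lemma exists_desc (n : ℕ) (w : Equiv.Perm (Fin n)) (hw : w ≠ 1) :
    ∃ j, ∃ h : j + 1 < n, ¬ rasc n j h w := by
  by_contra hcon
  push Not at hcon
  apply hw
  have hm : StrictMono w := by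
    cases n with
    | zero => intro a; exact a.elim0
    | succ m =>
      rw [Fin.strictMono_iff_lt_succ]
      intro i
      exact hcon i (by omega)
  have : (w : Fin n → Fin n) = id := by
    apply (hm.range_inj strictMono_id).1
    simp
  ext x
  rw [this]; rfl

/-- left ascent -/
def lasc (n j : ℕ) (h : j + 1 < n) (w : Equiv.Perm (Fin n)) : Prop := rasc n j h w⁻¹

def L (n : ℕ) (w : Equiv.Perm (Fin n)) : ℕ := inv n w⁻¹

lemma lasc_mul (n j : ℕ) (h : j + 1 < n) (w : Equiv.Perm (Fin n)) :
    lasc n j h (sgen n j * w) ↔ ¬ lasc n j h w := by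
  unfold lasc
  rw [mul_inv_rev, sgen_inv, rasc_mul]

lemma L_mul (n j : ℕ) (h : j + 1 < n) (w : Equiv.Perm (Fin n)) (ha : lasc n j h w) :
    L n (sgen n j * w) = L n w + 1 := by
  unfold L
  rw [mul_inv_rev, sgen_inv, inv_mul n j h _ ha]

lemma L_mul_desc (n j : ℕ) (h : j + 1 < n) (w : Equiv.Perm (Fin n)) (ha : ¬ lasc n j h w) :
    L n (sgen n j * w) + 1 = L n w := by
  unfold L
  rw [mul_inv_rev, sgen_inv, inv_mul_desc n j h _ ha]

lemma exists_word (n : ℕ) : ∀ (k : ℕ) (w : Equiv.Perm (Fin n)), L n w = k →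
    ∃ l : List ℕ, (∀ j ∈ l, j + 1 < n) ∧ l.length = k ∧ wordProd n l = w := by
  intro k
  induction k with
  | zero =>
    intro w hw
    refine ⟨[], by simp, rfl, ?_⟩
    by_contra hne
    have : w⁻¹ ≠ 1 := by
      intro h; apply hne; simp [wordProd, inv_eq_one.1 h]
    obtain ⟨j, h, hd⟩ := exists_desc n _ this
    have := inv_mul_desc n j h _ hd
    unfold L at hw
    omega
  | succ k ih =>
    intro w hw
    have : w⁻¹ ≠ 1 := by
      intro h; unfold L at hw; rw [h, inv_one] at hw; omega
    obtain ⟨j, h, hd⟩ := exists_desc n _ this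
    have h2 := L_mul_desc n j h w hd
    obtain ⟨l, hl, hlen, hp⟩ := ih (sgen n j * w) (by omega)
    refine ⟨j :: l, ?_, by simp [hlen], ?_⟩
    · intro i hi
      rcases List.mem_cons.1 hi with rfl | hi
      · exact h
      · exact hl i hi
    · unfold wordProd at hp ⊢
      rw [List.map_cons, List.prod_cons, hp, sgen_cancel]

lemma wordProd_cons (n j : ℕ) (l : List ℕ) : wordProd n (j :: l) = sgen n j * wordProd n l := by
  simp [wordProd]

lemma L_word_le (n : ℕ) (l : List ℕ) (hl : ∀ j ∈ l, j + 1 < n) : L n (wordProd n l) ≤ l.length := by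
  induction l with
  | nil => simp [wordProd, L, inv_one]
  | cons j l ih =>
    have h := hl j (by simp)
    have := ih (fun i hi => hl i (by simp [hi]))
    rw [wordProd_cons, List.length_cons]
    by_cases ha : lasc n j h (wordProd n l)
    · rw [L_mul n j h _ ha]; omega
    · have := L_mul_desc n j h _ ha; omega

lemma len_eq (n : ℕ) (w : Equiv.Perm (Fin n)) : len n w = L n w := by
  unfold len
  apply le_antisymm
  · exact Nat.sInf_le (exists_word n _ w rfl)
  · apply le_csInf
    · exact ⟨_, exists_word n _ w rfl⟩
    · rintro k ⟨l, hl, rfl, rfl⟩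
      exact L_word_le n l hl

lemma redWord_spec (n : ℕ) (w : Equiv.Perm (Fin n)) :
    (∀ j ∈ redWord n w, j + 1 < n) ∧ (redWord n w).length = len n w ∧
      wordProd n (redWord n w) = w := by
  have h : ∃ l : List ℕ, (∀ j ∈ l, j + 1 < n) ∧ l.length = len n w ∧ wordProd n l = w := by
    rw [len_eq]; exact exists_word n _ w rfl
  unfold redWord
  rw [dif_pos h]
  exact h.choose_spec

lemma L_inv_le (n : ℕ) (w : Equiv.Perm (Fin n)) : L n w⁻¹ ≤ L n w := by
  obtain ⟨l, hl, h1, h2⟩ := exists_word n _ w rfl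
  have : wordProd n l.reverse = w⁻¹ := by
    rw [← h2]
    unfold wordProd
    rw [List.prod_inv_reverse, List.map_reverse, List.map_map]
    congr 3
    funext j
    simp [sgen_inv]
  rw [← this, ← h1, ← List.length_reverse]
  exact L_word_le n _ (by simpa using hl)

lemma L_inv (n : ℕ) (w : Equiv.Perm (Fin n)) : L n w⁻¹ = L n w := by
  apply le_antisymm (L_inv_le n w)
  simpa using L_inv_le n w⁻¹

/-! ### Relations -/

lemma Tg_quad (n j : ℕ) (h : j + 1 < n) :
    Tg n j * Tg n j = (tt - 1) • Tg n j + tH n := by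
  have := RingQuot.mkAlgHom_rel HR (ARel.quad j h)
  simpa [Tg, tH] using this

lemma Tg_braid (n j : ℕ) (h : j + 2 < n) :
    Tg n j * Tg n (j + 1) * Tg n j = Tg n (j + 1) * Tg n j * Tg n (j + 1) := by
  have := RingQuot.mkAlgHom_rel HR (ARel.braid j h)
  simpa [Tg] using this

lemma Tg_comm (n j k : ℕ) (hjk : j + 1 < k) (hk : k + 1 < n) :
    Tg n j * Tg n k = Tg n k * Tg n j := by
  have := RingQuot.mkAlgHom_rel HR (ARel.commT j k hjk hk)
  simpa [Tg] using this

lemma sgen_braid (n j : ℕ) (h : j + 2 < n) :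
    sgen n j * sgen n (j + 1) * sgen n j = sgen n (j + 1) * sgen n j * sgen n (j + 1) := by
  ext x
  simp only [Equiv.Perm.mul_apply]
  simp only [sgen_val n j (by omega), sgen_val n (j+1) (by omega)]
  split_ifs <;> omega

lemma sgen_comm (n j k : ℕ) (hjk : j + 1 < k) (hk : k + 1 < n) :
    sgen n j * sgen n k = sgen n k * sgen n j := by
  ext x
  simp only [Equiv.Perm.mul_apply]
  simp only [sgen_val n j (by omega), sgen_val n k (by omega)]
  split_ifs <;> omega

lemma TofWord_cons (n j : ℕ) (l : List ℕ) : TofWord n (j :: l) = Tg n j * TofWord n l := by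
  simp [TofWord]

lemma mats_helper (n i j : ℕ) (hij : i < j) (hi : i + 1 < n) (hj : j + 1 < n)
    (w : Equiv.Perm (Fin n)) (hdi : ¬ lasc n i hi w) (hdj : ¬ lasc n j hj w) :
    ∃ a b : List ℕ, (∀ k ∈ i :: a, k + 1 < n) ∧ (∀ k ∈ j :: b, k + 1 < n) ∧
      wordProd n (i :: a) = w ∧ wordProd n (j :: b) = w ∧
      (i :: a).length = L n w ∧ (j :: b).length = L n w ∧
      TofWord n (i :: a) = TofWord n (j :: b) := by
  by_cases hc : i + 1 < j
  · have e1 := L_mul_desc n i hi w hdi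
    have hd2 : ¬ lasc n j hj (sgen n i * w) := by
      unfold lasc rasc at hdj ⊢
      rw [mul_inv_rev, sgen_inv, Equiv.Perm.mul_apply, Equiv.Perm.mul_apply]
      have : sgen n i ⟨j, by omega⟩ = ⟨j, by omega⟩ := by
        ext; rw [sgen_val n i hi]; simp only; split_ifs <;> omega
      rw [this]
      have : sgen n i ⟨j + 1, by omega⟩ = ⟨j + 1, by omega⟩ := by
        ext; rw [sgen_val n i hi]; simp only; split_ifs <;> omega
      rw [this]; exact hdj
    have e2 := L_mul_desc n j hj _ hd2
    obtain ⟨c, hc1, hc2, hc3⟩ := exists_word n _ (sgen n j * (sgen n i * w)) rfl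
    refine ⟨j :: c, i :: c, ?_, ?_, ?_, ?_, ?_, ?_, ?_⟩
    · simp [hi, hj]; exact hc1
    · simp [hi, hj]; exact hc1
    · rw [wordProd_cons, wordProd_cons, hc3, sgen_cancel, sgen_cancel]
    · rw [wordProd_cons, wordProd_cons, hc3, ← mul_assoc, ← sgen_comm n i j hc hj, mul_assoc,
        sgen_cancel, sgen_cancel]
    · simp; omega
    · simp; omega
    · simp only [TofWord_cons, ← mul_assoc]
      rw [Tg_comm n i j hc hj]
  · obtain rfl : j = i + 1 := by omega
    have e1 := L_mul_desc n i hi w hdi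
    have f1 : sgen n i ⟨i + 2, by omega⟩ = ⟨i + 2, by omega⟩ := by
      ext; rw [sgen_val n i hi]; simp
    have f2 : sgen n i ⟨i + 1, by omega⟩ = ⟨i, by omega⟩ := sgen_j1 n i hi
    have f3 : sgen n (i + 1) ⟨i, by omega⟩ = ⟨i, by omega⟩ := by
      ext; rw [sgen_val n _ hj]; simp only; split_ifs <;> omega
    have f4 : sgen n (i + 1) ⟨i + 1, by omega⟩ = ⟨i + 2, by omega⟩ := sgen_j n _ hj
    have f5 : sgen n i ⟨i, by omega⟩ = ⟨i + 1, by omega⟩ := sgen_j n i hi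
    have hd2 : ¬ lasc n (i + 1) hj (sgen n i * w) := by
      unfold lasc rasc at hdi hdj ⊢
      rw [mul_inv_rev, sgen_inv, Equiv.Perm.mul_apply, Equiv.Perm.mul_apply, f1, f2]
      rw [not_lt] at *
      exact hdj.trans hdi
    have e2 := L_mul_desc n (i + 1) hj _ hd2
    have hd3 : ¬ lasc n i hi (sgen n (i + 1) * (sgen n i * w)) := by
      unfold lasc rasc at hdi hdj ⊢
      rw [mul_inv_rev, mul_inv_rev, sgen_inv, sgen_inv]
      simp only [Equiv.Perm.mul_apply]
      rw [f3, f4, f1, f5]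
      exact hdj
    have e3 := L_mul_desc n i hi _ hd3
    obtain ⟨c, hc1, hc2, hc3⟩ := exists_word n _ (sgen n i * (sgen n (i + 1) * (sgen n i * w))) rfl
    have key : wordProd n (i :: (i + 1) :: i :: c) = w := by
      simp only [wordProd_cons, hc3, sgen_cancel]
    refine ⟨(i + 1) :: i :: c, i :: (i + 1) :: c, ?_, ?_, key, ?_, ?_, ?_, ?_⟩
    · simp [hi, hj]; exact hc1
    · simp [hi, hj]; exact hc1
    · rw [← key]; simp only [wordProd_cons, ← mul_assoc]
      rw [sgen_braid n i (by omega)]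
    · simp; omega
    · simp; omega
    · simp only [TofWord_cons, ← mul_assoc]
      rw [Tg_braid n i (by omega)]

lemma mats_helper' (n i j : ℕ) (hij : i ≠ j) (hi : i + 1 < n) (hj : j + 1 < n)
    (w : Equiv.Perm (Fin n)) (hdi : ¬ lasc n i hi w) (hdj : ¬ lasc n j hj w) :
    ∃ a b : List ℕ, (∀ k ∈ i :: a, k + 1 < n) ∧ (∀ k ∈ j :: b, k + 1 < n) ∧
      wordProd n (i :: a) = w ∧ wordProd n (j :: b) = w ∧
      (i :: a).length = L n w ∧ (j :: b).length = L n w ∧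
      TofWord n (i :: a) = TofWord n (j :: b) := by
  rcases lt_or_gt_of_ne hij with h | h
  · exact mats_helper n i j h hi hj w hdi hdj
  · obtain ⟨a, b, h1, h2, h3, h4, h5, h6, h7⟩ := mats_helper n j i h hj hi w hdj hdi
    exact ⟨b, a, h2, h1, h4, h3, h6, h5, h7.symm⟩

lemma red_cons (n i : ℕ) (a : List ℕ) (hv : ∀ k ∈ i :: a, k + 1 < n)
    (hl : (i :: a).length = L n (wordProd n (i :: a))) :
    a.length = L n (wordProd n a) ∧ ¬ lasc n i (hv i (by simp)) (wordProd n (i :: a)) := by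
  have hle := L_word_le n a (fun k hk => hv k (by simp [hk]))
  have h := hv i (by simp)
  rw [wordProd_cons] at hl ⊢
  rw [List.length_cons] at hl
  by_cases ha : lasc n i h (wordProd n a)
  · rw [L_mul n i h _ ha] at hl
    refine ⟨by omega, ?_⟩
    rw [lasc_mul, not_not]; exact ha
  · have := L_mul_desc n i h _ ha
    omega

/-- Matsumoto-type statement. -/
lemma matsumoto (n : ℕ) : ∀ (k : ℕ) (l l' : List ℕ), (∀ j ∈ l, j + 1 < n) → (∀ j ∈ l', j + 1 < n) →
    l.length = k → l'.length = k → L n (wordProd n l) = k → wordProd n l = wordProd n l' →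
    TofWord n l = TofWord n l' := by
  intro k
  induction k with
  | zero =>
    intro l l' _ _ h1 h2 _ _
    rw [List.length_eq_zero_iff.1 h1, List.length_eq_zero_iff.1 h2]
  | succ k ih =>
    intro l l' hv hv' h1 h2 hL hp
    obtain ⟨i, a, rfl⟩ := List.exists_cons_of_length_eq_add_one h1
    obtain ⟨j, b, rfl⟩ := List.exists_cons_of_length_eq_add_one h2
    have sub : ∀ (i : ℕ) (a a' : List ℕ), (∀ m ∈ i :: a, m + 1 < n) → (∀ m ∈ i :: a', m + 1 < n) →
        (i :: a).length = k + 1 → (i :: a').length = k + 1 → L n (wordProd n (i :: a)) = k + 1 →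
        wordProd n (i :: a) = wordProd n (i :: a') →
        TofWord n (i :: a) = TofWord n (i :: a') := by
      intro i a a' v v' g1 g2 g3 g4
      rw [TofWord_cons, TofWord_cons]
      congr 1
      have := (red_cons n i a v (by rw [g1, g3])).1
      simp only [List.length_cons, add_left_inj] at g1 g2
      apply ih _ _ (fun m hm => v m (by simp [hm])) (fun m hm => v' m (by simp [hm])) g1 g2
      · omega
      · simpa [wordProd_cons] using g4
    by_cases hij : i = j
    · subst hij
      exact sub i a b hv hv' h1 h2 hL hp
    · have d1 := (red_cons n i a hv (by rw [h1, hL])).2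
      have d2 := (red_cons n j b hv' (by rw [h2, ← hp, hL])).2
      rw [← hp] at d2
      obtain ⟨a', b', g1, g2, g3, g4, g5, g6, g7⟩ := mats_helper' n i j hij _ _ _ d1 d2
      rw [sub i a a' hv g1 h1 (by omega) hL g3.symm, g7,
        sub j b b' hv' g2 h2 (by omega) (by rw [← hp, hL]) (by rw [← hp, g4])]

lemma Tw_eq_word (n : ℕ) (l : List ℕ) (hv : ∀ j ∈ l, j + 1 < n)
    (hl : l.length = L n (wordProd n l)) : Tw n (wordProd n l) = TofWord n l := by
  obtain ⟨h1, h2, h3⟩ := redWord_spec n (wordProd n l)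
  rw [len_eq, ← hl] at h2
  exact matsumoto n l.length _ _ h1 hv h2 rfl (by rw [h3, hl]) h3

lemma Tw_left (n j : ℕ) (h : j + 1 < n) (w : Equiv.Perm (Fin n)) (ha : lasc n j h w) :
    Tw n (sgen n j * w) = Tg n j * Tw n w := by
  obtain ⟨l, h1, h2, rfl⟩ := exists_word n _ w rfl
  rw [Tw_eq_word n l h1 h2, ← TofWord_cons, ← wordProd_cons]
  apply Tw_eq_word
  · simp [h]; exact h1
  · rw [wordProd_cons, L_mul n j h _ ha, List.length_cons, h2]

lemma Tw_right (n j : ℕ) (h : j + 1 < n) (w : Equiv.Perm (Fin n)) (ha : rasc n j h w) :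
    Tw n (w * sgen n j) = Tw n w * Tg n j := by
  obtain ⟨l, h1, h2, rfl⟩ := exists_word n _ w rfl
  have e : wordProd n l * sgen n j = wordProd n (l ++ [j]) := by simp [wordProd]
  have e2 : TofWord n l * Tg n j = TofWord n (l ++ [j]) := by simp [TofWord]
  rw [Tw_eq_word n l h1 h2, e, e2]
  apply Tw_eq_word
  · intro k hk
    rcases List.mem_append.1 hk with hk | hk
    · exact h1 k hk
    · simp at hk; omega
  · rw [← e, List.length_append, h2, ← L_inv n (_ * _), ← L_inv n (wordProd n l)]
    unfold L
    rw [inv_inv, inv_inv, inv_mul n j h _ ha]; rfl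

lemma Tw_one (n : ℕ) : Tw n 1 = 1 := by
  have := Tw_eq_word n [] (by simp) (by simp [wordProd, L, inv_one])
  simpa [wordProd, TofWord] using this

end HLHecke
namespace HLHecke

/-! ### A representation -/

def tti : HR := LaurentPolynomial.T (-1)

lemma tt_tti : tt * tti = 1 := by
  unfold tt tti
  rw [← LaurentPolynomial.T_add]; simp

lemma tti_tt : tti * tt = 1 := by rw [mul_comm, tt_tti]

section JM

variable {A : Type} [Ring A] [Algebra HR A] (n : ℕ) (S : ℕ → A)

def Xop : ℕ → A
  | 0 => 1
  | j + 1 => tti • (S j * Xop j * S j)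

variable (hquad : ∀ j, j + 1 < n → S j * S j = (tt - 1) • S j + algebraMap HR A tt)
  (hbraid : ∀ j, j + 2 < n → S j * S (j + 1) * S j = S (j + 1) * S j * S (j + 1))
  (hcomm : ∀ j k, j + 1 < k → k + 1 < n → S j * S k = S k * S j)

include hquad in
lemma S_unit (j : ℕ) (h : j + 1 < n) : IsUnit (S j) := by
  have e1 : S j * (tti • (S j + (1 - tt) • 1)) = 1 := by
    rw [mul_smul_comm, mul_add, hquad j h, mul_smul_comm, mul_one, Algebra.algebraMap_eq_smul_one]
    rw [add_right_comm, ← add_smul]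
    simp [smul_smul, tti_tt]
  have e2 : (tti • (S j + (1 - tt) • 1)) * S j = 1 := by
    rw [smul_mul_assoc, add_mul, hquad j h, smul_mul_assoc, one_mul, Algebra.algebraMap_eq_smul_one]
    rw [add_right_comm, ← add_smul]
    simp [smul_smul, tti_tt]
  exact ⟨⟨_, _, e1, e2⟩, rfl⟩

include hquad in
lemma X_unit (k : ℕ) (h : k < n) : IsUnit (Xop S k) := by
  induction k with
  | zero => exact isUnit_one
  | succ k ih =>
    have hs := S_unit n S hquad k h
    have := (hs.mul (ih (by omega))).mul hs
    rw [Xop, Algebra.smul_def]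
    refine IsUnit.mul ?_ this
    exact (IsUnit.of_mul_eq_one _ tti_tt).map (algebraMap HR A)

include hcomm in
lemma X_comm_lt (j k : ℕ) (hkj : k < j) (hj : j + 1 < n) : Commute (S j) (Xop S k) := by
  induction k with
  | zero => exact Commute.one_right _
  | succ k ih =>
    have h1 : Commute (S j) (S k) := (hcomm k j hkj hj).symm
    rw [Xop]
    exact ((h1.mul_right (ih (by omega))).mul_right h1).smul_right _

include hcomm hbraid in
lemma X_comm_gt (j k : ℕ) (hkj : j + 2 ≤ k) (hk : k < n) : Commute (S j) (Xop S k) := by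
  induction k, hkj using Nat.le_induction with
  | base =>
    rw [Xop, Xop]
    rw [mul_smul_comm, smul_mul_assoc]
    refine Commute.smul_right (Commute.smul_right ?_ _) _
    have hb := hbraid j hk
    have hX : S (j + 1) * Xop S j = Xop S j * S (j + 1) :=
      X_comm_lt n S hcomm (j + 1) j (by omega) (by omega)
    rw [Commute, SemiconjBy]
    calc S j * (S (j + 1) * (S j * Xop S j * S j) * S (j + 1))
        = (S j * S (j + 1) * S j) * Xop S j * S j * S (j + 1) := by simp only [mul_assoc]
      _ = S (j + 1) * S j * (S (j + 1) * Xop S j) * S j * S (j + 1) := by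
        rw [hb]; simp only [mul_assoc]
      _ = S (j + 1) * S j * Xop S j * (S (j + 1) * S j * S (j + 1)) := by
        rw [hX]; simp only [mul_assoc]
      _ = _ := by rw [← hb]; simp only [mul_assoc]
  | succ k hk' ih =>
    have h1 : Commute (S j) (S k) := hcomm j k (by omega) hk
    rw [Xop]
    exact ((h1.mul_right (ih (by omega))).mul_right h1).smul_right _

include hcomm hbraid in
lemma X_comm_X (i k : ℕ) (hik : i < k) (hk : k < n) : Commute (Xop S i) (Xop S k) := by
  induction i with
  | zero => exact Commute.one_left _
  | succ i ih =>
    have h1 := X_comm_gt n S hbraid hcomm i k (by omega) hk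
    rw [Xop]
    exact ((h1.mul_left (ih (by omega))).mul_left h1).smul_left _

def genMap : AGen n → A
  | AGen.T j => S j
  | AGen.X i => Xop S i
  | AGen.Xinv i => Ring.inverse (Xop S i)

include hquad hbraid hcomm in
lemma exists_rep (hjunk : ∀ j, ¬ j + 1 < n → S j = 1) :
    ∃ ρ : H n →ₐ[HR] A, ∀ j, ρ (Tg n j) = S j := by
  let f : FA n →ₐ[HR] A := FreeAlgebra.lift HR (genMap n S)
  have fT' : ∀ j, f (fT n j) = S j := fun j => by simp [f, fT, genMap]
  have fX' : ∀ j, f (fX n j) = Xop S j := fun j => by simp [f, fX, genMap]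
  have fXi' : ∀ j, f (fXi n j) = Ring.inverse (Xop S j) := fun j => by simp [f, fXi, genMap]
  have hf : ∀ ⦃x y⦄, ARel n x y → f x = f y := by
    intro x y h
    cases h with
    | junk j h => rw [fT', map_one, hjunk j h]
    | quad j h =>
      rw [map_mul, map_add, map_smul, fT', hquad j h, AlgHom.commutes]
    | braid j h => simp only [map_mul, fT', hbraid j h]
    | commT j k h1 h2 => simp only [map_mul, fT', hcomm j k h1 h2]
    | commX i i' =>
      simp only [map_mul, fX']
      rcases lt_trichotomy (i : ℕ) i' with h | h | h
      · exact X_comm_X n S hbraid hcomm i i' h i'.2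
      · rw [h]
      · exact (X_comm_X n S hbraid hcomm i' i h i.2).symm
    | XinvL i =>
      rw [map_mul, fX', fXi', map_one, Ring.mul_inverse_cancel _ (X_unit n S hquad i i.2)]
    | XinvR i =>
      rw [map_mul, fX', fXi', map_one, Ring.inverse_mul_cancel _ (X_unit n S hquad i i.2)]
    | TXT j h =>
      simp only [map_mul, map_smul, fX', fT', Xop, smul_smul, tt_tti, one_smul]
    | TXcomm j h i h1 h2 =>
      simp only [map_mul, fX', fT']
      rcases lt_or_ge (i : ℕ) j with h3 | h3
      · exact X_comm_lt n S hcomm j i h3 h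
      · exact X_comm_gt n S hbraid hcomm j i (by omega) i.2
  refine ⟨RingQuot.liftAlgHom HR ⟨f, hf⟩, fun j => ?_⟩
  rw [Tg, RingQuot.liftAlgHom_mkAlgHom_apply, fT']

end JM

abbrev Fun (n : ℕ) := Equiv.Perm (Fin n) → HR

def Top (n j : ℕ) : Module.End HR (Fun n) :=
  if h : j + 1 < n then
    { toFun := fun φ w => if rasc n j h w then tt * φ (w * sgen n j)
        else (tt - 1) * φ w + φ (w * sgen n j)
      map_add' := by
        intro x y; ext1 w; simp only [Pi.add_apply]; split_ifs <;> ring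
      map_smul' := by
        intro c x; ext1 w; simp only [Pi.smul_apply, smul_eq_mul, RingHom.id_apply]
        split_ifs <;> ring }
  else 1

lemma Top_apply (n j : ℕ) (h : j + 1 < n) (φ : Fun n) (w : Equiv.Perm (Fin n)) :
    Top n j φ w = if rasc n j h w then tt * φ (w * sgen n j)
        else (tt - 1) * φ w + φ (w * sgen n j) := by
  simp [Top, h]

lemma Top_quad (n j : ℕ) (h : j + 1 < n) :
    Top n j * Top n j = (tt - 1) • Top n j + algebraMap HR _ tt := by
  refine LinearMap.ext fun φ => ?_
  funext w
  simp only [Module.End.mul_apply, LinearMap.add_apply, LinearMap.smul_apply,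
    Module.algebraMap_end_apply, Pi.add_apply, Pi.smul_apply, smul_eq_mul]
  simp only [Top_apply n j h, rasc_mul, sgen_cancel_right]
  split_ifs <;> ring

lemma rasc_far (n j k : ℕ) (hj : j + 1 < n) (hk : k + 1 < n) (h : j + 1 < k ∨ k + 1 < j)
    (w : Equiv.Perm (Fin n)) : rasc n k hk (w * sgen n j) ↔ rasc n k hk w := by
  unfold rasc
  rw [Equiv.Perm.mul_apply, Equiv.Perm.mul_apply]
  have : sgen n j ⟨k, by omega⟩ = ⟨k, by omega⟩ := by
    ext; rw [sgen_val n j hj]; simp only; split_ifs <;> omega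
  rw [this]
  have : sgen n j ⟨k + 1, by omega⟩ = ⟨k + 1, by omega⟩ := by
    ext; rw [sgen_val n j hj]; simp only; split_ifs <;> omega
  rw [this]

lemma Top_comm (n j k : ℕ) (hjk : j + 1 < k) (hk : k + 1 < n) :
    Top n j * Top n k = Top n k * Top n j := by
  have hj : j + 1 < n := by omega
  refine LinearMap.ext fun φ => ?_
  funext w
  simp only [Module.End.mul_apply, Top_apply n j hj, Top_apply n k hk,
    rasc_far n j k hj hk (Or.inl hjk), rasc_far n k j hk hj (Or.inr hjk)]
  rw [mul_assoc, mul_assoc, sgen_comm n j k hjk hk]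
  split_ifs <;> ring

lemma Top_braid (n j : ℕ) (h : j + 2 < n) :
    Top n j * Top n (j + 1) * Top n j = Top n (j + 1) * Top n j * Top n (j + 1) := by
  have hj : j + 1 < n := by omega
  have f1 : sgen n j ⟨j + 2, by omega⟩ = ⟨j + 2, by omega⟩ := by
    ext; rw [sgen_val n j hj]; simp
  have f2 : sgen n j ⟨j + 1, by omega⟩ = ⟨j, by omega⟩ := sgen_j1 n j hj
  have f3 : sgen n (j + 1) ⟨j, by omega⟩ = ⟨j, by omega⟩ := by
    ext; rw [sgen_val n _ h]; simp only; split_ifs <;> omega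
  have f4 : sgen n (j + 1) ⟨j + 1, by omega⟩ = ⟨j + 2, by omega⟩ := sgen_j n _ h
  have f5 : sgen n j ⟨j, by omega⟩ = ⟨j + 1, by omega⟩ := sgen_j n j hj
  have f6 : sgen n (j + 1) ⟨j + 2, by omega⟩ = ⟨j + 1, by omega⟩ := sgen_j1 n _ h
  refine LinearMap.ext fun φ => ?_
  funext w
  have hb : w * sgen n j * sgen n (j + 1) * sgen n j
      = w * sgen n (j + 1) * sgen n j * sgen n (j + 1) := by
    have := congrArg (w * ·) (sgen_braid n j h)
    simpa only [mul_assoc] using this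
  have hab : w ⟨j, by omega⟩ ≠ w ⟨j + 1, by omega⟩ := by
    intro e; simpa using w.injective e
  have hbc : w ⟨j + 1, by omega⟩ ≠ w ⟨j + 2, by omega⟩ := by
    intro e; simpa using w.injective e
  have hac : w ⟨j, by omega⟩ ≠ w ⟨j + 2, by omega⟩ := by
    intro e; simpa using w.injective e
  have r1 : rasc n (j + 1) h (w * sgen n j) ↔ w ⟨j, by omega⟩ < w ⟨j + 2, by omega⟩ := by
    unfold rasc
    rw [Equiv.Perm.mul_apply, Equiv.Perm.mul_apply, f1, f2]
  have r2 : rasc n j hj (w * sgen n (j + 1)) ↔ w ⟨j, by omega⟩ < w ⟨j + 2, by omega⟩ := by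
    unfold rasc
    rw [Equiv.Perm.mul_apply, Equiv.Perm.mul_apply, f3, f4]
  have r3 : rasc n j hj (w * sgen n j * sgen n (j + 1)) ↔ rasc n (j + 1) h w := by
    unfold rasc
    simp only [Equiv.Perm.mul_apply]
    rw [f3, f4, f5, f1]
  have r4 : rasc n (j + 1) h (w * sgen n (j + 1) * sgen n j) ↔ rasc n j hj w := by
    unfold rasc
    simp only [Equiv.Perm.mul_apply]
    rw [f1, f2, f6, f3]
  simp only [Module.End.mul_apply, Top_apply n j hj, Top_apply n (j + 1) h, rasc_mul,
    r1, r2, r3, r4, sgen_cancel_right, hb]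
  have i1 : rasc n j hj w → rasc n (j + 1) h w → w ⟨j, by omega⟩ < w ⟨j + 2, by omega⟩ :=
    fun a b => lt_trans a b
  have i2 : ¬ rasc n j hj w → ¬ rasc n (j + 1) h w → ¬ w ⟨j, by omega⟩ < w ⟨j + 2, by omega⟩ := by
    unfold rasc
    intro a b
    rw [not_lt] at *
    exact le_trans b a
  by_cases hQ : rasc n j hj w <;> by_cases hR : rasc n (j + 1) h w <;>
    by_cases hP : w ⟨j, by omega⟩ < w ⟨j + 2, by omega⟩ <;>
    first
    | exact absurd (i1 hQ hR) hP
    | exact absurd hP (i2 hQ hR)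
    | (simp only [hQ, hR, hP, not_true, not_false_iff, if_true, if_false]; done)
    | (simp only [hQ, hR, hP, not_true, not_false_iff, if_true, if_false]
       ring)

/-- Delta function. -/
def dl (n : ℕ) (w : Equiv.Perm (Fin n)) : Fun n := fun v => if v = w then 1 else 0

lemma Top_dl (n j : ℕ) (h : j + 1 < n) (w : Equiv.Perm (Fin n)) (ha : rasc n j h w) :
    Top n j (dl n w) = dl n (w * sgen n j) := by
  funext v
  rw [Top_apply n j h]
  by_cases h1 : v = w
  · subst h1
    have h2 : v * sgen n j ≠ v := by
      intro h2
      have := rasc_mul n j h v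
      rw [h2] at this
      tauto
    simp [dl, ha, h2, h2.symm]
  · by_cases h2 : v = w * sgen n j
    · subst h2
      rw [if_neg (by rw [rasc_mul, not_not]; exact ha)]
      simp [dl, sgen_cancel_right, h1]
    · have h3 : v * sgen n j ≠ w := by
        rintro rfl; exact h2 (sgen_cancel_right _ _ _).symm
      simp [dl, h1, h2, h3]

lemma exists_coeff (n : ℕ) : ∃ c : Equiv.Perm (Fin n) → (H n →ₗ[HR] HR),
    ∀ v w, c v (Tw n w) = if v = w then 1 else 0 := by
  obtain ⟨ρ, hρ⟩ := exists_rep n (Top n) (Top_quad n) (Top_braid n) (Top_comm n)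
    (fun j hj => by simp [Top, hj])
  have key : ∀ (k : ℕ) (w : Equiv.Perm (Fin n)), L n w = k → ρ (Tw n w) (dl n 1) = dl n w⁻¹ := by
    intro k
    induction k with
    | zero =>
      intro w hw
      obtain ⟨l, _, h2, rfl⟩ := exists_word n _ w hw
      rw [List.length_eq_zero_iff.1 h2]
      simp [wordProd, Tw_one]
    | succ k ih =>
      intro w hw
      obtain ⟨l, h1, h2, rfl⟩ := exists_word n _ w hw
      obtain ⟨j, a, rfl⟩ := List.exists_cons_of_length_eq_add_one h2
      have h := h1 j (by simp)
      obtain ⟨g1, g2⟩ := red_cons n j a h1 (by rw [h2, hw])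
      rw [wordProd_cons, lasc_mul, not_not] at g2
      rw [wordProd_cons, Tw_left n j h _ g2, map_mul, Module.End.mul_apply, hρ,
        ih _ (by simp at h2; omega), Top_dl n j h _ g2, mul_inv_rev, sgen_inv]
  refine ⟨fun v => (LinearMap.proj v⁻¹).comp ((LinearMap.applyₗ (dl n 1)).comp ρ.toLinearMap), ?_⟩
  intro v w
  simp [key _ w rfl, dl]

end HLHecke
namespace HLHecke

lemma perm_apply_inv (n : ℕ) (w : Equiv.Perm (Fin n)) (x : Fin n) : w (w⁻¹ x) = x := by simp

lemma perm_inv_apply (n : ℕ) (w : Equiv.Perm (Fin n)) (x : Fin n) : w⁻¹ (w x) = x := by simp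

/-! ### Columns -/

/-- Preservation of the block `{i < ℓ}`. -/
def Pst (n ℓ : ℕ) (w : Equiv.Perm (Fin n)) : Prop := ∀ i : Fin n, ((w i : ℕ) < ℓ ↔ (i : ℕ) < ℓ)

lemma stab_iff (n ℓ : ℕ) (w : Equiv.Perm (Fin n)) :
    wAct n w (varpi n ℓ) = varpi n ℓ ↔ Pst n ℓ w := by
  unfold wAct varpi Pst
  rw [funext_iff]
  constructor
  · intro h i
    have := h (w i)
    simp only [perm_inv_apply] at this
    split_ifs at this <;> omega
  · intro h i
    have := h (w⁻¹ i)
    simp only [perm_apply_inv] at this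
    by_cases h1 : (i : ℕ) < ℓ
    · rw [if_pos h1, if_pos (this.1 h1)]
    · rw [if_neg h1, if_neg (fun h2 => h1 (this.2 h2))]

lemma Pst_one (n ℓ : ℕ) : Pst n ℓ 1 := fun _ => Iff.rfl

lemma Pst_mul (n ℓ : ℕ) (v w : Equiv.Perm (Fin n)) (hv : Pst n ℓ v) :
    Pst n ℓ (v * w) ↔ Pst n ℓ w := by
  unfold Pst
  simp only [Equiv.Perm.mul_apply]
  exact forall_congr' fun i => by rw [hv (w i)]

lemma Pst_mul_right (n ℓ : ℕ) (v w : Equiv.Perm (Fin n)) (hv : Pst n ℓ v) (hw : Pst n ℓ w) :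
    Pst n ℓ (v * w) := (Pst_mul n ℓ v w hv).2 hw

lemma Pst_inv (n ℓ : ℕ) (v : Equiv.Perm (Fin n)) (hv : Pst n ℓ v) : Pst n ℓ v⁻¹ := by
  intro i
  have := hv (v⁻¹ i)
  rw [perm_apply_inv] at this
  exact this.symm

lemma Pst_sgen (n ℓ k : ℕ) (hk : k + 1 < n) (h : k + 1 ≠ ℓ) : Pst n ℓ (sgen n k) := by
  intro i
  rw [sgen_val n k hk]
  split_ifs <;> omega

structure IsCol (n : ℕ) (C : Finset (Fin n)) (u : Equiv.Perm (Fin n)) : Prop where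
  mem : ∀ i, u i ∈ C ↔ (i : ℕ) < C.card
  lo : ∀ a b : Fin n, a < b → (b : ℕ) < C.card → u a < u b
  hi : ∀ a b : Fin n, a < b → C.card ≤ (a : ℕ) → u a < u b

lemma colPerm_lo (n : ℕ) (C : Finset (Fin n)) (i : Fin n) (h : (i : ℕ) < C.card) :
    colPerm n C i = C.orderEmbOfFin rfl ⟨i, h⟩ := by
  have e : (finCongr ((Nat.add_sub_cancel' (col_card_le n C)).symm)) i
      = Fin.castAdd (n - C.card) ⟨i, h⟩ := by
    ext; rfl
  simp only [colPerm, Equiv.trans_apply]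
  rw [e, finSumFinEquiv_symm_apply_castAdd]
  rfl

lemma colPerm_hi (n : ℕ) (C : Finset (Fin n)) (i : Fin n) (h : C.card ≤ (i : ℕ)) :
    colPerm n C i = Cᶜ.orderEmbOfFin (k := n - C.card) (by simp [Finset.card_compl])
      ⟨i - C.card, by omega⟩ := by
  have e : (finCongr ((Nat.add_sub_cancel' (col_card_le n C)).symm)) i
      = Fin.natAdd C.card ⟨i - C.card, by omega⟩ := by
    ext; simp; omega
  simp only [colPerm, Equiv.trans_apply]
  rw [e, finSumFinEquiv_symm_apply_natAdd]
  rfl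

lemma isCol_colPerm (n : ℕ) (C : Finset (Fin n)) : IsCol n C (colPerm n C) where
  mem := by
    intro i
    constructor
    · intro hm
      by_contra h
      rw [colPerm_hi n C i (by omega)] at hm
      have := Finset.orderEmbOfFin_mem Cᶜ (k := n - C.card) (by simp [Finset.card_compl])
        ⟨i - C.card, by omega⟩
      exact (Finset.mem_compl.1 this) hm
    · intro h
      rw [colPerm_lo n C i h]
      exact Finset.orderEmbOfFin_mem _ _ _
  lo := by
    intro a b hab hb
    have hab' : (a : ℕ) < b := hab
    rw [colPerm_lo n C b hb, colPerm_lo n C a (by omega), OrderEmbedding.lt_iff_lt]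
    exact hab
  hi := by
    intro a b hab ha
    have hab' : (a : ℕ) < b := hab
    rw [colPerm_hi n C a ha, colPerm_hi n C b (by omega), OrderEmbedding.lt_iff_lt]
    rw [Fin.mk_lt_mk]
    omega

lemma perm_one_of_strictMono (n : ℕ) (w : Equiv.Perm (Fin n)) (hm : StrictMono w) : w = 1 := by
  have : (w : Fin n → Fin n) = id := by
    apply (hm.range_inj strictMono_id).1
    simp
  ext x
  rw [this]; rfl

lemma isCol_unique (n : ℕ) (C : Finset (Fin n)) (u u' : Equiv.Perm (Fin n)) (h : IsCol n C u)
    (h' : IsCol n C u') : u' = u := by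
  have hv : u⁻¹ * u' = 1 := by
    apply perm_one_of_strictMono
    have hu : ∀ x, u ((u⁻¹ * u') x) = u' x := fun x => by simp
    generalize u⁻¹ * u' = v at hu ⊢
    have hb : ∀ x, ((v x : ℕ) < C.card ↔ (x : ℕ) < C.card) := fun x => by
      rw [← h.mem, hu, h'.mem]
    intro a b hab
    have hab' : (a : ℕ) < b := hab
    by_contra hcon
    have hne : v b ≠ v a := fun e => (ne_of_gt hab) (v.injective e)
    have hlt : v b < v a := lt_of_le_of_ne (not_lt.1 hcon) hne
    have hlt' : (v b : ℕ) < v a := hlt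
    have ha2 := hb a
    have hb2 := hb b
    by_cases h1 : (b : ℕ) < C.card
    · have g1 := h'.lo a b hab h1
      have g2 := h.lo (v b) (v a) hlt (by omega)
      rw [hu, hu] at g2
      exact lt_asymm g1 g2
    · by_cases h2 : (a : ℕ) < C.card
      · omega
      · have g1 := h'.hi a b hab (by omega)
        have g2 := h.hi (v b) (v a) hlt (by omega)
        rw [hu, hu] at g2
        exact lt_asymm g1 g2
  exact (inv_mul_eq_one.1 hv).symm

lemma mem_sCol (n j : ℕ) (E : Finset (Fin n)) (x : Fin n) : x ∈ sCol n j E ↔ sgen n j x ∈ E := by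
  unfold sCol
  rw [Finset.mem_image]
  constructor
  · rintro ⟨y, hy, rfl⟩; rwa [sgen_sgen]
  · intro h; exact ⟨_, h, sgen_sgen _ _ _⟩

lemma card_sCol (n j : ℕ) (E : Finset (Fin n)) : (sCol n j E).card = E.card :=
  Finset.card_image_of_injective _ (sgen n j).injective

lemma col_swap (n j : ℕ) (hj : j + 1 < n) (E : Finset (Fin n))
    (h0 : (⟨j, Nat.lt_of_succ_lt hj⟩ : Fin n) ∉ E) (h1 : (⟨j + 1, hj⟩ : Fin n) ∈ E) :
    colPerm n (sCol n j E) = sgen n j * colPerm n E := by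
  have hE := isCol_colPerm n E
  refine isCol_unique n (sCol n j E) _ _ ?_ (isCol_colPerm _ _)
  constructor
  · intro i
    rw [mem_sCol, Equiv.Perm.mul_apply, sgen_sgen, hE.mem, card_sCol]
  · intro a b hab hb
    rw [card_sCol] at hb
    have hab' : (a : ℕ) < b := hab
    refine sgen_lt n j hj _ _ (hE.lo a b hab hb) ?_
    rintro ⟨h2, -⟩
    have : colPerm n E a ∈ E := (hE.mem a).2 (by omega)
    rw [show colPerm n E a = ⟨j, by omega⟩ from Fin.ext h2] at this
    exact h0 this
  · intro a b hab ha
    rw [card_sCol] at ha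
    have hab' : (a : ℕ) < b := hab
    refine sgen_lt n j hj _ _ (hE.hi a b hab ha) ?_
    rintro ⟨-, h2⟩
    rw [← show colPerm n E b = ⟨j + 1, hj⟩ from Fin.ext h2, hE.mem] at h1
    omega

lemma colPerm_inv_lt (n : ℕ) (E : Finset (Fin n)) (x : Fin n) :
    ((((colPerm n E)⁻¹ x : Fin n) : ℕ) < E.card) ↔ x ∈ E := by
  rw [← (isCol_colPerm n E).mem, perm_apply_inv]

lemma lasc_swap (n j : ℕ) (hj : j + 1 < n) (E : Finset (Fin n))
    (h0 : (⟨j, Nat.lt_of_succ_lt hj⟩ : Fin n) ∉ E) (h1 : (⟨j + 1, hj⟩ : Fin n) ∈ E) :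
    lasc n j hj (colPerm n (sCol n j E)) := by
  have e1 := colPerm_inv_lt n (sCol n j E) ⟨j, by omega⟩
  have e2 := colPerm_inv_lt n (sCol n j E) ⟨j + 1, hj⟩
  rw [mem_sCol, sgen_j n j hj] at e1
  rw [mem_sCol, sgen_j1 n j hj] at e2
  have e1 := e1.2 h1
  have e2 : ¬ (((colPerm n (sCol n j E))⁻¹ ⟨j + 1, hj⟩ : Fin n) : ℕ) < (sCol n j E).card :=
    fun h => h0 (e2.1 h)
  unfold lasc rasc
  rw [Fin.lt_def]
  omega

lemma sCol_fix (n j : ℕ) (hj : j + 1 < n) (E : Finset (Fin n))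
    (h : (⟨j, Nat.lt_of_succ_lt hj⟩ : Fin n) ∈ E ↔ (⟨j + 1, hj⟩ : Fin n) ∈ E) : sCol n j E = E := by
  ext x
  rw [mem_sCol]
  by_cases h1 : (x : ℕ) = j
  · have hx : x = ⟨j, Nat.lt_of_succ_lt hj⟩ := Fin.ext h1
    rw [hx, sgen_j n j hj, h]
  · by_cases h2 : (x : ℕ) = j + 1
    · have hx : x = ⟨j + 1, hj⟩ := Fin.ext h2
      rw [hx, sgen_j1 n j hj, h]
    · have : sgen n j x = x := by
        ext; rw [sgen_val n j hj]; simp [h1, h2]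
      rw [this]

lemma col_fix (n j : ℕ) (hj : j + 1 < n) (E : Finset (Fin n))
    (h : (⟨j, Nat.lt_of_succ_lt hj⟩ : Fin n) ∈ E ↔ (⟨j + 1, hj⟩ : Fin n) ∈ E) :
    ∃ k, ∃ hk : k + 1 < n, sgen n j * colPerm n E = colPerm n E * sgen n k ∧ k + 1 ≠ E.card ∧
      rasc n j hj (colPerm n E)⁻¹ ∧ rasc n k hk (colPerm n E) := by
  have hE := isCol_colPerm n E
  obtain ⟨a, ha⟩ : ∃ a, a = (colPerm n E)⁻¹ ⟨j, by omega⟩ := ⟨_, rfl⟩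
  obtain ⟨b, hb⟩ : ∃ b, b = (colPerm n E)⁻¹ ⟨j + 1, hj⟩ := ⟨_, rfl⟩
  have ha' : colPerm n E a = ⟨j, by omega⟩ := by rw [ha, perm_apply_inv]
  have hb' : colPerm n E b = ⟨j + 1, hj⟩ := by rw [hb, perm_apply_inv]
  have hblk : ((a : ℕ) < E.card ↔ (b : ℕ) < E.card) := by
    rw [← hE.mem, ← hE.mem, ha', hb', h]
  have mono : ∀ x y : Fin n, x < y → ((x : ℕ) < E.card ↔ (y : ℕ) < E.card) →
      (colPerm n E x : ℕ) < colPerm n E y := by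
    intro x y hxy hb
    by_cases h1 : (y : ℕ) < E.card
    · exact hE.lo x y hxy h1
    · exact hE.hi x y hxy (by omega)
  have hab : (a : ℕ) < b := by
    rcases lt_trichotomy a b with h1 | h1 | h1
    · exact h1
    · rw [h1, hb'] at ha'
      have := congrArg Fin.val ha'
      change j + 1 = j at this
      omega
    · have := mono b a h1 hblk.symm
      rw [ha', hb'] at this
      change j + 1 < j at this
      omega
  have hbe : (b : ℕ) = a + 1 := by
    by_contra hne
    have hc : (a : ℕ) + 1 < n := by omega
    have m1 := mono a ⟨a + 1, hc⟩ (by rw [Fin.lt_def]; simp) (by simp only; omega)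
    have m2 := mono ⟨a + 1, hc⟩ b (by rw [Fin.lt_def]; simp only; omega) (by simp only; omega)
    rw [ha'] at m1
    rw [hb'] at m2
    simp only at m1 m2
    omega
  have hk : (a : ℕ) + 1 < n := by omega
  have eb : b = ⟨a + 1, hk⟩ := Fin.ext hbe
  refine ⟨a, hk, ?_, by omega, ?_, ?_⟩
  · rw [sgen_eq n j hj, sgen_eq n a hk, Equiv.swap_mul_eq_mul_swap, ← ha, ← hb, eb]
  · unfold rasc
    rw [← ha, ← hb]; exact hab
  · unfold rasc
    rw [← eb, hb']
    change colPerm n E a < _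
    rw [ha', Fin.lt_def]
    exact Nat.lt_succ_self j

lemma Tw_col_mul (n : ℕ) (C : Finset (Fin n)) : ∀ (k : ℕ) (v : Equiv.Perm (Fin n)), inv n v = k →
    Pst n C.card v → Tw n (colPerm n C * v) = Tw n (colPerm n C) * Tw n v := by
  have hC := isCol_colPerm n C
  intro k
  induction k with
  | zero =>
    intro v hv _
    have : v = 1 := by
      by_contra hne
      obtain ⟨j, h, hd⟩ := exists_desc n v hne
      have := inv_mul_desc n j h v hd
      omega
    rw [this, mul_one, Tw_one, mul_one]
  | succ k ih =>
    intro v hv hP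
    have hne : v ≠ 1 := by rintro rfl; rw [inv_one] at hv; omega
    obtain ⟨j, h, hd⟩ := exists_desc n v hne
    have h1 := inv_mul_desc n j h v hd
    have hjc : j + 1 ≠ C.card := by
      intro hjc
      apply hd
      have e1 := (hP ⟨j, by omega⟩).2 (by simp only; omega)
      have e2 : ¬ (v ⟨j + 1, h⟩ : ℕ) < C.card := fun hh => not_lt_of_ge hjc.ge ((hP ⟨j + 1, h⟩).1 hh)
      unfold rasc
      rw [Fin.lt_def]; omega
    have hP' : Pst n C.card (v * sgen n j) := Pst_mul_right n _ _ _ hP (Pst_sgen n _ j h hjc)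
    have ha := (rasc_mul n j h v).2 hd
    have e : v = v * sgen n j * sgen n j := (sgen_cancel_right _ _ _).symm
    have ih' := ih (v * sgen n j) (by omega) hP'
    generalize v * sgen n j = v' at *
    subst e
    rw [Tw_right n j h v' ha, ← mul_assoc, ← mul_assoc, ← ih', Tw_right n j h]
    unfold rasc at ha ⊢
    simp only [Equiv.Perm.mul_apply]
    have e1 := hP' ⟨j, by omega⟩
    have e2 := hP' ⟨j + 1, by omega⟩
    simp only at e1 e2
    by_cases hh : j + 1 < C.card
    · exact hC.lo _ _ ha (e2.2 hh)
    · exact hC.hi _ _ ha (by omega)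

lemma Tg_onePara (n ℓ k : ℕ) (hk : k + 1 < n) (h : k + 1 ≠ ℓ) :
    Tg n k * onePara n (varpi n ℓ) = tH n * onePara n (varpi n ℓ) := by
  unfold onePara
  have hs : ∀ v, v ∈ stabFinset n (varpi n ℓ) ↔ Pst n ℓ v := fun v => by
    simp [stabFinset, stab_iff]
  set A := stabFinset n (varpi n ℓ) with hA
  have hsA : ∀ v, v ∈ A → sgen n k * v ∈ A := fun v hv => by
    rw [hs] at hv ⊢; exact Pst_mul_right n _ _ _ (Pst_sgen n ℓ k hk h) hv
  have key : ∑ v ∈ A with ¬ lasc n k hk v, Tw n (sgen n k * v) = ∑ v ∈ A with lasc n k hk v, Tw n v := by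
    refine Finset.sum_nbij' (fun v => sgen n k * v) (fun v => sgen n k * v) ?_ ?_ ?_ ?_ ?_
    · intro v hv
      rw [Finset.mem_filter] at hv ⊢
      exact ⟨hsA v hv.1, (lasc_mul n k hk v).2 hv.2⟩
    · intro v hv
      rw [Finset.mem_filter] at hv ⊢
      exact ⟨hsA v hv.1, by rw [lasc_mul, not_not]; exact hv.2⟩
    · intro v _; exact sgen_cancel _ _ _
    · intro v _; exact sgen_cancel _ _ _
    · intro v _; rfl
  have key2 : ∑ v ∈ A with lasc n k hk v, Tw n (sgen n k * v) = ∑ v ∈ A with ¬ lasc n k hk v, Tw n v := by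
    refine Finset.sum_nbij' (fun v => sgen n k * v) (fun v => sgen n k * v) ?_ ?_ ?_ ?_ ?_
    · intro v hv
      rw [Finset.mem_filter] at hv ⊢
      exact ⟨hsA v hv.1, by rw [lasc_mul, not_not]; exact hv.2⟩
    · intro v hv
      rw [Finset.mem_filter] at hv ⊢
      exact ⟨hsA v hv.1, (lasc_mul n k hk v).2 hv.2⟩
    · intro v _; exact sgen_cancel _ _ _
    · intro v _; exact sgen_cancel _ _ _
    · intro v _; rfl
  have t1 : ∑ v ∈ A with lasc n k hk v, Tg n k * Tw n v
      = ∑ v ∈ A with lasc n k hk v, Tw n (sgen n k * v) :=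
    Finset.sum_congr rfl fun v hv => (Tw_left n k hk v (Finset.mem_filter.1 hv).2).symm
  have t2 : ∑ v ∈ A with ¬ lasc n k hk v, Tg n k * Tw n v
      = ∑ v ∈ A with ¬ lasc n k hk v, ((tt - 1) • Tw n v + tH n * Tw n (sgen n k * v)) := by
    refine Finset.sum_congr rfl fun v hv => ?_
    have := Tw_left n k hk (sgen n k * v) ((lasc_mul n k hk v).2 (Finset.mem_filter.1 hv).2)
    rw [sgen_cancel] at this
    rw [this, ← mul_assoc, Tg_quad n k hk, add_mul, smul_mul_assoc]
  rw [Finset.mul_sum, ← Finset.sum_filter_add_sum_filter_not A (fun v => lasc n k hk v),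
    ← Finset.sum_filter_add_sum_filter_not A (fun v => lasc n k hk v) (fun v => Tw n v), t1, t2,
    key2, Finset.sum_add_distrib, ← Finset.mul_sum, key, ← Finset.smul_sum, mul_add]
  unfold tH
  rw [Algebra.algebraMap_eq_smul_one, smul_mul_assoc, smul_mul_assoc, one_mul, one_mul]
  have fin : ∀ x y : H n, x + ((tt - 1) • x + tt • y) = tt • y + tt • x := by
    intro x y
    have e : tt • x = (1 + (tt - 1)) • x := congrArg (fun r : HR => r • x) (by ring)
    rw [e, add_smul, one_smul, add_comm (tt • y), add_assoc]
  exact fin _ _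

end HLHecke
namespace HLHecke

/-! ### The parabolic decomposition -/

lemma repr_para (n ℓ : ℕ) (c : Equiv.Perm (Fin n) → (H n →ₗ[HR] HR))
    (hc : ∀ v w, c v (Tw n w) = if v = w then 1 else 0) (g : H n)
    (hg : g ∈ HparaM n (varpi n ℓ)) :
    g = ∑ v with Pst n ℓ v, c v g • Tw n v := by
  unfold HparaM at hg
  induction hg using Submodule.span_induction with
  | mem x hx =>
    obtain ⟨w, hw, rfl⟩ := hx
    have hw' : Pst n ℓ w := (stab_iff n ℓ w).1 hw
    rw [Finset.sum_eq_single w]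
    · rw [hc, if_pos rfl, one_smul]
    · intro v _ hv
      rw [hc, if_neg hv, zero_smul]
    · intro h
      exact absurd (Finset.mem_filter.2 ⟨Finset.mem_univ _, hw'⟩) h
  | zero => 
    symm
    apply Finset.sum_eq_zero
    intro v _
    rw [map_zero, zero_smul]
  | add x y _ _ hx hy =>
    conv_lhs => rw [hx, hy]
    rw [← Finset.sum_add_distrib]
    refine Finset.sum_congr rfl fun v _ => ?_
    rw [map_add, add_smul]
  | smul a x _ hx =>
    conv_lhs => rw [hx]
    rw [Finset.smul_sum]
    refine Finset.sum_congr rfl fun v _ => ?_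
    rw [map_smul, smul_eq_mul, mul_smul]

lemma col_mul_inj (n ℓ : ℕ) (F G : Finset (Fin n)) (hF : F.card = ℓ) (hG : G.card = ℓ)
    (v w : Equiv.Perm (Fin n)) (hv : Pst n ℓ v) (hw : Pst n ℓ w)
    (h : colPerm n F * v = colPerm n G * w) : F = G := by
  ext x
  have e : ∀ (F : Finset (Fin n)) (hF : F.card = ℓ) (v : Equiv.Perm (Fin n)) (hv : Pst n ℓ v),
      x ∈ F ↔ (((colPerm n F * v)⁻¹ x : Fin n) : ℕ) < ℓ := by
    intro F hF v hv
    rw [mul_inv_rev, Equiv.Perm.mul_apply, Pst_inv n ℓ v hv, ← hF, colPerm_inv_lt]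
  rw [e F hF v hv, e G hG w hw, h]

lemma coeff_mul (n ℓ : ℕ) (c : Equiv.Perm (Fin n) → (H n →ₗ[HR] HR))
    (hc : ∀ v w, c v (Tw n w) = if v = w then 1 else 0) (g : H n)
    (hg : g ∈ HparaM n (varpi n ℓ)) (F G : Finset (Fin n)) (hF : F.card = ℓ) (hG : G.card = ℓ)
    (v : Equiv.Perm (Fin n)) (hv : Pst n ℓ v) :
    c (colPerm n F * v) (Tw n (colPerm n G) * g) = if F = G then c v g else 0 := by
  unfold HparaM at hg
  induction hg using Submodule.span_induction with
  | mem x hx =>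
    obtain ⟨w, hw, rfl⟩ := hx
    have hw' : Pst n ℓ w := (stab_iff n ℓ w).1 hw
    rw [← Tw_col_mul n G _ w rfl (by rw [hG]; exact hw'), hc, hc]
    by_cases h : F = G
    · subst h
      simp
    · rw [if_neg h, if_neg]
      exact fun e => h (col_mul_inj n ℓ F G hF hG v w hv hw' e)
  | zero => simp
  | add x y _ _ hx hy =>
    rw [mul_add, map_add, hx, hy]
    split_ifs
    · rw [map_add]
    · rw [add_zero]
  | smul a x _ hx =>
    rw [mul_smul_comm, map_smul, hx]
    split_ifs
    · rw [map_smul]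
    · rw [smul_zero]

lemma para_unique (n ℓ : ℕ) (g g' : Finset (Fin n) → H n)
    (hg : ∀ F : Finset (Fin n), F.card = ℓ → g F ∈ HparaM n (varpi n ℓ))
    (hg' : ∀ F : Finset (Fin n), F.card = ℓ → g' F ∈ HparaM n (varpi n ℓ))
    (h : ∑ F ∈ colFinset n ℓ, Tw n (colPerm n F) * g F
      = ∑ F ∈ colFinset n ℓ, Tw n (colPerm n F) * g' F)
    (C : Finset (Fin n)) (hC : C.card = ℓ) : g C = g' C := by
  obtain ⟨c, hc⟩ := exists_coeff n
  have key : ∀ g : Finset (Fin n) → H n,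
      (∀ F : Finset (Fin n), F.card = ℓ → g F ∈ HparaM n (varpi n ℓ)) →
      ∀ v, Pst n ℓ v → c (colPerm n C * v) (∑ F ∈ colFinset n ℓ, Tw n (colPerm n F) * g F)
        = c v (g C) := by
    intro g hg v hv
    rw [map_sum, Finset.sum_eq_single C]
    · rw [coeff_mul n ℓ c hc _ (hg C hC) C C hC hC v hv, if_pos rfl]
    · intro F hF hne
      have hF' : F.card = ℓ := (Finset.mem_filter.1 hF).2
      rw [coeff_mul n ℓ c hc _ (hg F hF') C F hC hF' v hv, if_neg (Ne.symm hne)]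
    · intro hn
      exact absurd (show C ∈ colFinset n ℓ from Finset.mem_filter.2 ⟨Finset.mem_univ _, hC⟩) hn
  rw [repr_para n ℓ c hc _ (hg C hC), repr_para n ℓ c hc _ (hg' C hC)]
  refine Finset.sum_congr rfl fun v hv => ?_
  have hv' := (Finset.mem_filter.1 hv).2
  rw [← key g hg v hv', ← key g' hg' v hv', h]

lemma paraCoeff_eq (n ℓ : ℕ) (h : H n) (g : Finset (Fin n) → H n)
    (hg : ∀ F : Finset (Fin n), F.card = ℓ → g F ∈ HparaM n (varpi n ℓ))
    (he : h = ∑ F ∈ colFinset n ℓ, Tw n (colPerm n F) * g F)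
    (C : Finset (Fin n)) (hC : C.card = ℓ) : paraCoeff n ℓ h C = g C := by
  have hex : ∃ g : Finset (Fin n) → H n,
      (∀ F : Finset (Fin n), F.card = ℓ → g F ∈ HparaM n (varpi n ℓ)) ∧
      h = ∑ F ∈ colFinset n ℓ, Tw n (colPerm n F) * g F := ⟨g, hg, he⟩
  unfold paraCoeff
  rw [dif_pos hex]
  have hs := hex.choose_spec
  exact para_unique n ℓ _ _ hs.1 hg (hs.2.symm.trans he) C hC

lemma paraCoeff_sum (n ℓ : ℕ) (A : Finset (Equiv.Perm (Fin n))) (C : Finset (Fin n))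
    (hC : C.card = ℓ) : paraCoeff n ℓ (∑ w ∈ A, Tw n w) C
      = ∑ v with Pst n ℓ v ∧ colPerm n C * v ∈ A, Tw n v := by
  refine paraCoeff_eq n ℓ _ (fun C => ∑ v with Pst n ℓ v ∧ colPerm n C * v ∈ A, Tw n v) ?_ ?_ C hC
  · intro F _
    refine Submodule.sum_mem _ fun v hv => Submodule.subset_span ?_
    exact ⟨v, (stab_iff n ℓ v).2 (Finset.mem_filter.1 hv).2.1, rfl⟩
  · have hl : ℓ ≤ n := hC ▸ col_card_le n C
    have hcard : ∀ w : Equiv.Perm (Fin n), ((hwCol n ℓ).image w).card = ℓ := by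
      intro w
      rw [Finset.card_image_of_injective _ w.injective]
      unfold hwCol
      rw [Fin.card_filter_val_lt]
      omega
    rw [← Finset.sum_fiberwise_of_maps_to (t := colFinset n ℓ)
      (g := fun w : Equiv.Perm (Fin n) => (hwCol n ℓ).image w)
      (fun w _ => Finset.mem_filter.2 ⟨Finset.mem_univ _, hcard w⟩)]
    refine Finset.sum_congr rfl fun F hF => ?_
    have hF' : F.card = ℓ := (Finset.mem_filter.1 hF).2
    have hu := isCol_colPerm n F
    rw [Finset.mul_sum]
    symm
    have hiff : ∀ v : Equiv.Perm (Fin n), (hwCol n ℓ).image (colPerm n F * v : Equiv.Perm (Fin n)) = F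
        ↔ Pst n ℓ v := by
      intro v
      constructor
      · intro h i
        have h0 : (colPerm n F * v) i ∈ F ↔
          (colPerm n F * v) i ∈ (hwCol n ℓ).image (colPerm n F * v : Equiv.Perm (Fin n)) := by rw [h]
        rw [(colPerm n F * v).injective.mem_finset_image, Equiv.Perm.mul_apply, hu.mem, hF'] at h0
        rw [h0]
        simp [hwCol]
      · intro h
        apply Finset.eq_of_subset_of_card_le
        · intro x hx
          obtain ⟨i, hi, rfl⟩ := Finset.mem_image.1 hx
          rw [Equiv.Perm.mul_apply, hu.mem, hF', h]
          exact (Finset.mem_filter.1 hi).2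
        · rw [hcard, hF']
    refine Finset.sum_nbij' (fun v => colPerm n F * v) (fun w => (colPerm n F)⁻¹ * w) ?_ ?_ ?_ ?_ ?_
    · intro v hv
      have hv := (Finset.mem_filter.1 hv).2
      exact Finset.mem_filter.2 ⟨hv.2, (hiff v).2 hv.1⟩
    · intro w hw
      have hw := Finset.mem_filter.1 hw
      refine Finset.mem_filter.2 ⟨Finset.mem_univ _, ?_, ?_⟩
      · rw [← hiff, mul_inv_cancel_left]; exact hw.2
      · rw [mul_inv_cancel_left]; exact hw.1
    · intro v _; exact inv_mul_cancel_left _ _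
    · intro v _; exact mul_inv_cancel_left _ _
    · intro v hv
      have hv := (Finset.mem_filter.1 hv).2
      exact (Tw_col_mul n F _ v rfl (by rw [hF']; exact hv.1)).symm

end HLHecke
namespace HLHecke

/-! ### Units and prefactors -/

lemma Tg_unit (n j : ℕ) (h : j + 1 < n) : IsUnit (Tg n j) :=
  S_unit n (Tg n) (fun j h => Tg_quad n j h) j h

lemma Tw_unit (n : ℕ) (w : Equiv.Perm (Fin n)) : IsUnit (Tw n w) := by
  have h := (redWord_spec n w).1
  unfold Tw TofWord
  generalize redWord n w = l at h
  induction l with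
  | nil => simp
  | cons a l ih =>
    rw [List.map_cons, List.prod_cons]
    exact (Tg_unit n a (h a (by simp))).mul (ih fun j hj => h j (by simp [hj]))

lemma tpow_comm (n k : ℕ) (x : H n) : tpow n k * x = x * tpow n k := Algebra.commutes _ _

lemma tH_comm (n : ℕ) (x : H n) : tH n * x = x * tH n := Algebra.commutes _ _

lemma tpow_succ (n k : ℕ) : tpow n (k + 1) = tH n * tpow n k := by
  unfold tpow tH
  rw [pow_succ', map_mul]

/-- The prefactor. -/
def pre (n : ℕ) (u : Equiv.Perm (Fin n)) : H n := tpow n (len n u) * Ring.inverse (Tw n u⁻¹)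

lemma inverse_mul (n : ℕ) (x y : H n) (hx : IsUnit x) (hy : IsUnit y) :
    Ring.inverse (x * y) = Ring.inverse y * Ring.inverse x := by
  obtain ⟨x, rfl⟩ := hx
  obtain ⟨y, rfl⟩ := hy
  rw [← Units.val_mul, Ring.inverse_unit, Ring.inverse_unit, Ring.inverse_unit, mul_inv_rev,
    Units.val_mul]

lemma pre_mul (n j : ℕ) (h : j + 1 < n) (u : Equiv.Perm (Fin n)) (ha : lasc n j h u) :
    pre n (sgen n j * u) = tH n * Ring.inverse (Tg n j) * pre n u := by
  unfold pre
  have e : (sgen n j * u)⁻¹ = u⁻¹ * sgen n j := by rw [mul_inv_rev, sgen_inv]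
  rw [e, Tw_right n j h u⁻¹ ha, inverse_mul n _ _ (Tw_unit n _) (Tg_unit n j h), len_eq, len_eq,
    L_mul n j h u ha, tpow_succ, mul_assoc, mul_assoc, ← mul_assoc (tpow n _), tpow_comm, mul_assoc]

lemma pre_swap (n j : ℕ) (hj : j + 1 < n) (E : Finset (Fin n))
    (h0 : (⟨j, Nat.lt_of_succ_lt hj⟩ : Fin n) ∉ E) (h1 : (⟨j + 1, hj⟩ : Fin n) ∈ E) :
    pre n (colPerm n E) = tH n * Ring.inverse (Tg n j) * pre n (colPerm n (sCol n j E)) := by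
  rw [← pre_mul n j hj _ (lasc_swap n j hj E h0 h1), col_swap n j hj E h0 h1, sgen_cancel]

lemma Psi_single (n : ℕ) (C : Finset (Fin n)) :
    Psi n [C] = pre n (colPerm n C) * onePara n (varpi n C.card) := by
  rw [Psi, pre]

lemma Psi_cons (n : ℕ) (C : Finset (Fin n)) (S : List (Finset (Fin n))) (hS : S ≠ []) :
    Psi n (C :: S) = pre n (colPerm n C) * paraCoeff n C.card (Psi n S) C := by
  cases S with
  | nil => exact absurd rfl hS
  | cons D S => rw [Psi, pre]; simp

lemma Psi_single_swap (n j : ℕ) (hj : j + 1 < n) (E : Finset (Fin n))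
    (h0 : (⟨j, Nat.lt_of_succ_lt hj⟩ : Fin n) ∉ E) (h1 : (⟨j + 1, hj⟩ : Fin n) ∈ E) :
    Psi n [E] = tH n * Ring.inverse (Tg n j) * Psi n [sCol n j E] := by
  rw [Psi_single, Psi_single, pre_swap n j hj E h0 h1, card_sCol, mul_assoc]

lemma Psi_single_fix (n j : ℕ) (hj : j + 1 < n) (E : Finset (Fin n))
    (h : (⟨j, Nat.lt_of_succ_lt hj⟩ : Fin n) ∈ E ↔ (⟨j + 1, hj⟩ : Fin n) ∈ E) :
    Psi n [E] = tH n * Ring.inverse (Tg n j) * Psi n [sCol n j E] := by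
  rw [sCol_fix n j hj E h, Psi_single]
  obtain ⟨k, hk, e1, e2, e3, e4⟩ := col_fix n j hj E h
  have c1 : Tw n (colPerm n E)⁻¹ * Tg n j = Tg n k * Tw n (colPerm n E)⁻¹ := by
    rw [← Tw_right n j hj _ e3, ← Tw_left n k hk _ (by unfold lasc; rw [inv_inv]; exact e4)]
    congr 1
    have := congrArg (fun w => w⁻¹) e1
    simpa only [mul_inv_rev, sgen_inv] using this
  have hu := Tw_unit n (colPerm n E)⁻¹
  have c2 : Tg n j * Ring.inverse (Tw n (colPerm n E)⁻¹)
      = Ring.inverse (Tw n (colPerm n E)⁻¹) * Tg n k := by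
    apply hu.mul_left_cancel
    rw [← mul_assoc, c1, mul_assoc, Ring.mul_inverse_cancel _ hu, ← mul_assoc,
      Ring.mul_inverse_cancel _ hu, mul_one, one_mul]
  apply (Tg_unit n j hj).mul_left_cancel
  have r1 : ∀ Y : H n, Tg n j * (tH n * Ring.inverse (Tg n j) * Y) = tH n * Y := by
    intro Y
    rw [tH_comm n (Ring.inverse (Tg n j)), ← mul_assoc, ← mul_assoc,
      Ring.mul_inverse_cancel _ (Tg_unit n j hj), one_mul]
  rw [r1]
  unfold pre
  rw [mul_assoc, ← mul_assoc (Tg n j), ← tpow_comm n _ (Tg n j), mul_assoc (tpow n _),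
    ← mul_assoc (Tg n j), c2, mul_assoc _ (Tg n k), Tg_onePara n _ k hk e2, ← mul_assoc _ (tH n),
    ← tH_comm, mul_assoc (tH n), ← mul_assoc (tpow n _) (tH n), tpow_comm, mul_assoc (tH n)]

/-! ### Highest weight tableaux -/

lemma card_hwCol (n k : ℕ) (hk : k ≤ n) : (hwCol n k).card = k := by
  unfold hwCol
  rw [Fin.card_filter_val_lt]
  omega

lemma colPerm_hwCol (n k : ℕ) (hk : k ≤ n) : colPerm n (hwCol n k) = 1 := by
  refine isCol_unique n (hwCol n k) 1 _ ⟨?_, fun a b h _ => h, fun a b h _ => h⟩ (isCol_colPerm _ _)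
  intro i
  rw [card_hwCol n k hk]
  simp [hwCol]

lemma pre_one (n : ℕ) : pre n 1 = 1 := by
  unfold pre
  rw [len_eq, L, _root_.inv_one, inv_one, Tw_one, Ring.inverse_one, mul_one, tpow, pow_zero, map_one]

lemma Psi_hw (n : ℕ) (ks : List ℕ) (hne : ks ≠ []) (hk : ∀ k ∈ ks, k ≤ n) :
    Psi n (ks.map (hwCol n)) = ∑ w with ∀ k ∈ ks, Pst n k w, Tw n w := by
  induction ks with
  | nil => exact absurd rfl hne
  | cons k ks ih =>
    have hkn : k ≤ n := hk k (by simp)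
    rcases eq_or_ne ks [] with rfl | hks
    · rw [List.map_cons, List.map_nil, Psi_single, colPerm_hwCol n k hkn, pre_one, one_mul,
        card_hwCol n k hkn]
      unfold onePara stabFinset
      refine Finset.sum_congr ?_ fun _ _ => rfl
      ext w
      simp [stab_iff]
    · rw [List.map_cons, Psi_cons _ _ _ (by simpa using hks), ih hks (fun i hi => hk i (by simp [hi])),
        paraCoeff_sum n _ _ _ rfl, colPerm_hwCol n k hkn, pre_one, one_mul, card_hwCol n k hkn]
      refine Finset.sum_congr ?_ fun _ _ => rfl
      ext w
      simp

lemma nth_eq (n : ℕ) (C : Finset (Fin n)) (i : Fin n) (h : (i : ℕ) < C.card) :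
    nth n C i = colPerm n C i := by
  rw [colPerm_lo n C i h, Finset.orderEmbOfFin_apply]
  unfold nth
  rw [List.getD_eq_getElem _ _ (by simpa using h)]
  simp

lemma fix_of_pairSS (n m : ℕ) (hm : m ≤ n) (E : Finset (Fin n)) (hmE : m ≤ E.card)
    (h : pairSS n E (hwCol n m)) : ∀ (k : ℕ) (i : Fin n), (i : ℕ) = k → k < m → colPerm n E i = i := by
  intro k
  induction k using Nat.strong_induction_on with
  | _ k ih =>
    intro i hi hkm
    have h1 := h i (by rw [card_hwCol n m hm]; omega)
    rw [nth_eq n E i (by omega), nth_eq n _ i (by rw [card_hwCol n m hm]; omega),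
      colPerm_hwCol n m hm, Equiv.Perm.one_apply] at h1
    rcases Nat.lt_or_ge (colPerm n E i : ℕ) i with h2 | h2
    · have := ih _ (by omega) (colPerm n E i) rfl (by omega)
      exact (colPerm n E).injective this
    · exact Fin.ext (by omega)

lemma Pst_of_fix (n m : ℕ) (u : Equiv.Perm (Fin n)) (h : ∀ i : Fin n, (i : ℕ) < m → u i = i)
    (k : ℕ) (hk : k ≤ m) : Pst n k u := by
  intro i
  constructor
  · intro h1
    have := u.injective (h (u i) (by omega))
    rw [this] at h1
    exact h1
  · intro h1
    rw [h i (by omega)]; exact h1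

lemma Psi_hw_swap (n j : ℕ) (hj : j + 1 < n) (E : Finset (Fin n)) (ks : List ℕ) (m : ℕ) (hm : m ≤ n)
    (hks : ∀ k ∈ ks, k ≤ m) (hne : ks ≠ []) (hmE : m ≤ E.card) (hp : pairSS n E (hwCol n m))
    (h0 : (⟨j, Nat.lt_of_succ_lt hj⟩ : Fin n) ∉ E) (h1 : (⟨j + 1, hj⟩ : Fin n) ∈ E) :
    Psi n (E :: ks.map (hwCol n))
      = tH n * Ring.inverse (Tg n j) * Psi n (sCol n j E :: ks.map (hwCol n)) := by
  have hne' : ks.map (hwCol n) ≠ [] := by simpa using hne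
  have fx : ∀ i : Fin n, (i : ℕ) < m → colPerm n E i = i := fun i hi =>
    fix_of_pairSS n m hm E hmE hp _ i rfl hi
  have hmj : m ≤ j := by
    by_contra hc
    apply h0
    have := fx ⟨j, by omega⟩ (by simp only; omega)
    rw [← this, (isCol_colPerm n E).mem]
    simp only; omega
  have fx' : ∀ i : Fin n, (i : ℕ) < m → colPerm n (sCol n j E) i = i := by
    intro i hi
    rw [col_swap n j hj E h0 h1, Equiv.Perm.mul_apply, fx i hi]
    apply Fin.ext
    rw [sgen_val n j hj]
    split_ifs <;> omega
  rw [Psi_cons _ _ _ hne', Psi_cons _ _ _ hne', pre_swap n j hj E h0 h1, card_sCol, mul_assoc]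
  congr 2
  rw [Psi_hw n ks hne (fun k hk => (hks k hk).trans hm), paraCoeff_sum n _ _ E rfl,
    paraCoeff_sum n _ _ (sCol n j E) (card_sCol n j E)]
  refine Finset.sum_congr ?_ fun _ _ => rfl
  ext v
  simp only [Finset.mem_filter, Finset.mem_univ, true_and]
  refine and_congr_right fun _ => forall₂_congr fun k hk => ?_
  rw [Pst_mul n k _ v (Pst_of_fix n m _ fx k (hks k hk)),
    Pst_mul n k _ v (Pst_of_fix n m _ fx' k (hks k hk))]

lemma shapeColLen_le (n : ℕ) (μ : Fin n → ℤ) (i : ℕ) : shapeColLen n μ i ≤ shapeColLen n μ 0 := by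
  unfold shapeColLen
  apply Finset.card_le_card
  intro x hx
  rw [Finset.mem_filter] at hx ⊢
  refine ⟨hx.1, lt_of_le_of_lt ?_ hx.2⟩
  push_cast; omega

lemma shapeColLen_le_n (n : ℕ) (μ : Fin n → ℤ) (i : ℕ) : shapeColLen n μ i ≤ n :=
  col_card_le n _

lemma hwTableau_eq (n : ℕ) (μ : Fin n → ℤ) : hwTableau n μ
    = (List.ofFn fun i : Fin (numCols n μ) => shapeColLen n μ (i : ℕ)).map (hwCol n) := by
  unfold hwTableau
  rw [List.map_ofFn]
  rfl

lemma part_one (n j : ℕ) (hj : j + 1 < n) (μ : Fin n → ℤ) (E : Finset (Fin n))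
    (hc : shapeColLen n μ 0 ≤ E.card) (hs : isSSYT n (E :: hwTableau n μ))
    (h0 : (⟨j, Nat.lt_of_succ_lt hj⟩ : Fin n) ∉ E) (h1 : (⟨j + 1, hj⟩ : Fin n) ∈ E) :
    Psi n (E :: hwTableau n μ)
      = tH n * Ring.inverse (Tg n j) * Psi n (sCol n j E :: hwTableau n μ) := by
  rcases Nat.eq_zero_or_pos (numCols n μ) with hz | hz
  · have : hwTableau n μ = [] := by
      apply List.eq_nil_of_length_eq_zero
      simp [hwTableau, hz]
    rw [this]
    exact Psi_single_swap n j hj E h0 h1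
  · rw [hwTableau_eq] at hs ⊢
    have hp : pairSS n E (hwCol n (shapeColLen n μ 0)) := by
      obtain ⟨N, hN⟩ := Nat.exists_eq_succ_of_ne_zero hz.ne'
      rw [hN, List.ofFn_succ, List.map_cons] at hs
      exact (List.isChain_cons_cons.1 hs).1
    refine Psi_hw_swap n j hj E _ (shapeColLen n μ 0) (shapeColLen_le_n n μ 0) ?_ ?_ hc hp h0 h1
    · intro k hk
      obtain ⟨i, rfl⟩ := (List.mem_ofFn' _ _).1 hk
      exact shapeColLen_le n μ _
    · intro h
      have := congrArg List.length h
      simp at this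
      omega

end HLHecke
namespace HLHecke

/-- (1) if `E ⊗ T⁰_λ` is semistandard with `j ∉ E`, `j+1 ∈ E` then
`Ψ_{E ⊗ T⁰_λ} = tT_j⁻¹ Ψ_{s_jE ⊗ T⁰_λ}`; (2) for any column `E` with `s_jE ≤ E`
(i.e. `j ∈ E → j+1 ∈ E`), `Ψ_E = tT_j⁻¹ Ψ_{s_jE}`. -/
theorem stmt14 (n : ℕ) (hn : 1 ≤ n) (j : ℕ) (hj : j + 1 < n) :
    (∀ lam : Fin n → ℤ, Antitone lam → (∀ i, 0 ≤ lam i) →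
      ∀ E : Finset (Fin n), 1 ≤ E.card → shapeColLen n lam 0 ≤ E.card →
        isSSYT n (E :: hwTableau n lam) →
        (⟨j, by omega⟩ : Fin n) ∉ E → (⟨j + 1, hj⟩ : Fin n) ∈ E →
        Psi n (E :: hwTableau n lam)
          = tH n * Ring.inverse (Tg n j) * Psi n (sCol n j E :: hwTableau n lam))
    ∧ (∀ E : Finset (Fin n), 1 ≤ E.card →
        ((⟨j, by omega⟩ : Fin n) ∈ E → (⟨j + 1, hj⟩ : Fin n) ∈ E) →
        Psi n [E] = tH n * Ring.inverse (Tg n j) * Psi n [sCol n j E]) := by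
  refine ⟨fun lam _ _ E _ hc hs h0 h1 => part_one n j hj lam E hc hs h0 h1, fun E _ h => ?_⟩
  by_cases h0 : (⟨j, by omega⟩ : Fin n) ∈ E
  · exact Psi_single_fix n j hj E ⟨fun _ => h h0, fun _ => h0⟩
  · by_cases h1 : (⟨j + 1, hj⟩ : Fin n) ∈ E
    · exact Psi_single_swap n j hj E h0 h1
    · exact Psi_single_fix n j hj E ⟨fun h2 => absurd h2 h0, fun h2 => absurd h2 h1⟩

end HLHecke
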